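/- arXiv:1004.4195 — 5 statements merged into one kernel-verified Lean document; each statement's English description precedes it below -/
import Mathlib

section
/- Fix integers g ≥ 2, p ≥ 0 and γ = (r,e) ∈ ℤ_{≥1} × ℤ. Let n ≥ 1, l_1, …, l_n ≥ 1 and let (γ_1, η_{1,1}, …, η_{1,l_1}, …, η_{n,1}, …, η_{n,l_n}) be elements of ℤ_{≥1} × ℤ such that γ_1 + Σ_{i=1}^n Σ_{j=1}^{l_i} η_{i,j} = γ, for each 1 ≤ i ≤ n all η_{i,1}, …, η_{i,l_i} have a common slope μ_i, and μ_0(r) ≤ μ(γ) < μ_1 < μ_2 < ⋯ < μ_n and μ_0(r) ≤ μ(γ_1). For 2 ≤ i ≤ n set γ_{n−i+2} := γ_1 + Σ_{i'≥i} Σ_j η_{i',j}, and define real numbers δ_1, …, δ_n by the conditions μ_{δ_1}(γ_1) = μ_n and μ_{δ_i}(γ_i) = μ_{n+1−i} for 2 ≤ i ≤ n. Then 0 < δ_n < δ_{n−1} < ⋯ < δ_1, and moreover μ(γ_i) ≥ μ_0(r) for all 1 ≤ i ≤ n. -/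
/-- Shifting the threshold of a tail sum by one adds one term. -/
theorem sum_range_tail_succ {M : Type*} [AddCommMonoid M] (f : ℕ → M) {n k : ℕ} (hk : k < n) :
    (∑ i ∈ Finset.range n, if n - (k + 1) ≤ i then f i else 0) =
      (∑ i ∈ Finset.range n, if n - k ≤ i then f i else 0) + f (n - 1 - k) := by
  have h : f (n - 1 - k) = ∑ i ∈ Finset.range n, if n - 1 - k = i then f i else 0 := by
    rw [Finset.sum_ite_eq, if_pos (Finset.mem_range.2 (by omega))]
  rw [h, ← Finset.sum_add_distrib]
  refine Finset.sum_congr rfl fun i _ => ?_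
  by_cases h1 : n - k ≤ i
  · rw [if_pos (by omega), if_pos h1, if_neg (by omega), add_zero]
  · by_cases h2 : n - 1 - k = i
    · rw [if_pos (by omega), if_neg h1, if_pos h2, zero_add]
    · rw [if_neg (by omega), if_neg h1, if_neg h2, zero_add]

/-- A nonempty sum of classes of positive rank has positive rank. -/
theorem one_le_fst_sum_range (f : ℕ → ℤ × ℤ) {l : ℕ} (hl : 1 ≤ l) (hf : ∀ j < l, 1 ≤ (f j).1) :
    1 ≤ (∑ j ∈ Finset.range l, f j).1 := by
  rw [Prod.fst_sum]
  exact Finset.sum_pos (fun j hj => Int.lt_of_lt_of_le one_pos <| hf j (Finset.mem_range.1 hj))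
    (Finset.nonempty_range_iff.2 (by omega))

/-- A sum of classes of a common slope `μ` has degree `μ` times its rank. -/
theorem snd_sum_range_of_slope (f : ℕ → ℤ × ℤ) {l : ℕ} (hf : ∀ j < l, 1 ≤ (f j).1) {μ : ℚ}
    (hμ : ∀ j < l, ((f j).2 : ℚ) / ((f j).1 : ℚ) = μ) :
    ((∑ j ∈ Finset.range l, f j).2 : ℚ) = μ * ((∑ j ∈ Finset.range l, f j).1 : ℚ) := by
  rw [Prod.fst_sum, Prod.snd_sum]
  push_cast
  rw [Finset.mul_sum]
  refine Finset.sum_congr rfl fun j hj => ?_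
  have hj := Finset.mem_range.1 hj
  have h0 : ((f j).1 : ℚ) ≠ 0 := by
    have := hf j hj
    exact_mod_cast (by omega : (f j).1 ≠ 0)
  exact (div_eq_iff h0).1 (hμ j hj)


/-- Given `g ≥ 2`, `p ≥ 0`, `γ = (r,e) ∈ ℤ_{≥1} × ℤ`, data
`(γ₁, η_{1,1}, …, η_{n,l_n})` in `ℤ_{≥1} × ℤ` with
`γ₁ + Σ_{i<n} Σ_{j<l_i} η_{i,j} = γ`, common slopes `μ_i` within each group,
`μ₀(r) ≤ μ(γ) < μ_1 < ⋯ < μ_n`, `μ₀(r) ≤ μ(γ₁)`, and with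
`γ_{n-i+2} = γ₁ + Σ_{i'≥i} Σ_j η_{i',j}` (here `Γ k`, 0-indexed, is the paper's
`γ_{k+1}`) and `δ_k` defined by `μ_{δ_k}(γ_k) = μ_{n+1-k}`, one has
`0 < δ_n < δ_{n-1} < ⋯ < δ_1` and `μ(γ_k) ≥ μ₀(r)` for all `k`.
Groups are 0-indexed: `μs i` is the paper's `μ_{i+1}`, `δ k` the paper's `δ_{k+1}`. -/
theorem stmt_1 (g p : ℤ) (hg : 2 ≤ g) (hp : 0 ≤ p)
    (r e : ℤ) (hr : 1 ≤ r)
    (n : ℕ) (hn : 1 ≤ n) (l : ℕ → ℕ) (hl : ∀ i < n, 1 ≤ l i)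
    (γ₁ : ℤ × ℤ) (hγ₁ : 1 ≤ γ₁.1)
    (η : ℕ → ℕ → ℤ × ℤ)
    (hη : ∀ i < n, ∀ j < l i, 1 ≤ (η i j).1)
    (μs : ℕ → ℚ)
    (hslope : ∀ i < n, ∀ j < l i, ((η i j).2 : ℚ) / ((η i j).1 : ℚ) = μs i)
    (hsum : γ₁ + ∑ i ∈ Finset.range n, ∑ j ∈ Finset.range (l i), η i j = (r, e))
    (hmono : ∀ i j, i < j → j < n → μs i < μs j)
    (hlow : ((-(r - 1) * (2 * g - 2 + p) : ℤ) : ℚ) ≤ (e : ℚ) / (r : ℚ))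
    (hμγ : (e : ℚ) / (r : ℚ) < μs 0)
    (hγ₁low : ((-(r - 1) * (2 * g - 2 + p) : ℤ) : ℚ) ≤ (γ₁.2 : ℚ) / (γ₁.1 : ℚ))
    (Γ : ℕ → ℤ × ℤ)
    (hΓ : ∀ k < n, Γ k = γ₁ + ∑ i ∈ Finset.range n,
        if n - k ≤ i then ∑ j ∈ Finset.range (l i), η i j else 0)
    (δ : ℕ → ℝ)
    (hδ : ∀ k < n, (((Γ k).2 : ℝ) + δ k) / ((Γ k).1 : ℝ) = ((μs (n - 1 - k) : ℚ) : ℝ)) :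
    (0 < δ (n - 1)) ∧
    (∀ k k', k < k' → k' < n → δ k' < δ k) ∧
    (∀ k < n, ((-(r - 1) * (2 * g - 2 + p) : ℤ) : ℚ) ≤ ((Γ k).2 : ℚ) / ((Γ k).1 : ℚ)) := by
  set m : ℚ := ((-(r - 1) * (2 * g - 2 + p) : ℤ) : ℚ)
  let S : ℕ → ℤ × ℤ := fun i => ∑ j ∈ Finset.range (l i), η i j
  let G : ℕ → ℤ × ℤ := fun k => γ₁ + ∑ i ∈ Finset.range n, if n - k ≤ i then S i else 0
  have hS1 : ∀ i < n, (1 : ℚ) ≤ (S i).1 := fun i hi => by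
    exact_mod_cast one_le_fst_sum_range (η i) (hl i hi) (hη i hi)
  have hS2 : ∀ i < n, ((S i).2 : ℚ) = μs i * (S i).1 := fun i hi =>
    snd_sum_range_of_slope (η i) (hη i hi) (hslope i hi)
  have hG0 : G 0 = γ₁ := by
    have : (∑ i ∈ Finset.range n, if n - 0 ≤ i then S i else 0) = 0 :=
      Finset.sum_eq_zero fun i hi => if_neg (by have := Finset.mem_range.1 hi; omega)
    simp only [G, this, add_zero]
  have hGn : G n = (r, e) := by
    rw [← hsum]
    simp [G, S]
  have hGs : ∀ k < n, G (k + 1) = G k + S (n - 1 - k) := fun k hk => by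
    simp only [G, sum_range_tail_succ S hk, add_assoc]
  have hGs1 : ∀ k < n, ((G (k + 1)).1 : ℚ) = (G k).1 + (S (n - 1 - k)).1 := fun k hk => by
    rw [hGs k hk, Prod.fst_add]; push_cast; rfl
  have hGs2 : ∀ k < n,
      ((G (k + 1)).2 : ℚ) = (G k).2 + μs (n - 1 - k) * (S (n - 1 - k)).1 := fun k hk => by
    rw [hGs k hk, Prod.snd_add, ← hS2 _ (by omega)]; push_cast; rfl
  have hmμ : ∀ i < n, m < μs i := fun i hi => by
    rcases Nat.eq_zero_or_pos i with rfl | h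
    · exact hlow.trans_lt hμγ
    · exact (hlow.trans_lt hμγ).trans (hmono 0 i h hi)
  have hG : ∀ k ≤ n, (1 : ℚ) ≤ (G k).1 ∧ m * (G k).1 ≤ (G k).2 := by
    intro k
    induction k with
    | zero =>
      intro _
      rw [hG0]
      have h1 : (1 : ℚ) ≤ γ₁.1 := by exact_mod_cast hγ₁
      exact ⟨h1, (le_div_iff₀ (by linarith)).1 hγ₁low⟩
    | succ k ih =>
      intro hk
      obtain ⟨h1, h2⟩ := ih (by omega)
      have h3 := hS1 (n - 1 - k) (by omega)
      have h4 := hmμ (n - 1 - k) (by omega)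
      rw [hGs1 k hk, hGs2 k hk]
      exact ⟨by linarith, by nlinarith⟩
  have hΓG : ∀ k < n, Γ k = G k := hΓ
  let d : ℕ → ℚ := fun k => μs (n - 1 - k) * (G k).1 - (G k).2
  have hδd : ∀ k < n, δ k = (d k : ℝ) := by
    intro k hk
    have h := hδ k hk
    rw [hΓG k hk] at h
    have h1 : (1 : ℝ) ≤ (G k).1 := by exact_mod_cast (hG k hk.le).1
    rw [div_eq_iff (by linarith)] at h
    simp only [d]
    push_cast
    linarith
  have hstep : ∀ k, k + 1 < n → d (k + 1) < d k := by
    intro k hk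
    have h1 := hGs1 k (by omega)
    have h2 := hGs2 k (by omega)
    have h3 := hmono (n - 1 - (k + 1)) (n - 1 - k) (by omega) (by omega)
    have h4 := (hG (k + 1) (by omega)).1
    simp only [d]
    rw [h2, eq_sub_of_add_eq h1.symm]
    have h5 := mul_lt_mul_of_pos_right h3 (by linarith : (0 : ℚ) < (G (k + 1)).1)
    linarith
  have hanti : ∀ k k', k < k' → k' < n → d k' < d k := by
    intro k k' hkk'
    induction k', hkk' using Nat.le_induction with
    | base => exact hstep k
    | succ j _ ih => exact fun hj => (hstep j hj).trans (ih (by omega))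
  refine ⟨?_, fun k k' h h' => ?_, fun k hk => ?_⟩
  · rw [hδd _ (by omega)]
    have h1 := hGs1 (n - 1) (by omega)
    have h2 := hGs2 (n - 1) (by omega)
    have hr' : (0 : ℚ) < r := by exact_mod_cast (by omega : 0 < r)
    have h3 := (div_lt_iff₀ hr').1 hμγ
    rw [Nat.sub_add_cancel hn, hGn, Nat.sub_self] at h1 h2
    have : 0 < d (n - 1) := by
      simp only [d, Nat.sub_self]
      dsimp only at h1 h2
      rw [h1] at h3
      linarith
    exact_mod_cast this
  · rw [hδd k' h', hδd k (h.trans h')]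
    exact_mod_cast hanti k k' h h'
  · rw [hΓG k hk]
    obtain ⟨h1, h2⟩ := hG k hk.le
    exact (le_div_iff₀ (by linarith)).2 h2
end

section
/- Fix an integer g ≥ 2 and let F = ℚ(y) be the field of rational functions in one variable y over ℚ. Let B, H : ℤ_{≥1} × ℤ → F be functions such that H(γ) = H(γ̃) for every γ, where γ̃ := (r, −e + 2r(g−1)) for γ = (r,e). Then for every γ ∈ ℤ_{≥1} × ℤ and every l ≥ 2, the sum Σ B(γ̃_1)·∏_{i=2}^{l} s(γ_i)H(γ_i), taken over all ordered tuples (γ_1, …, γ_l) in ℤ_{≥1} × ℤ with γ_1 + ⋯ + γ_l = γ and μ(γ_i) = μ(γ) for all 1 ≤ i ≤ l, equals (−1)^{l−1} times the sum Σ B(γ_1)·∏_{i=2}^{l} s(γ_i)H(γ_i), taken over all ordered tuples (γ_1, …, γ_l) with γ_1 + ⋯ + γ_l = γ̃ and μ(γ_i) = μ(γ̃) for all i. Both sums have only finitely many terms. -/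
open scoped Classical

noncomputable section

/-- `γ̃ = (r, -e + 2r(g-1))` for `γ = (r,e)`. -/
def tilde (g : ℤ) (γ : ℤ × ℤ) : ℤ × ℤ := (γ.1, -γ.2 + 2 * γ.1 * (g - 1))

/-- The slopeZ `μ(r,e) = e/r ∈ ℚ`. -/
def slopeZ (γ : ℤ × ℤ) : ℚ := (γ.2 : ℚ) / (γ.1 : ℚ)

/-- `[n]_y = (y^n - y^{-n})/(y - y⁻¹) ∈ ℚ(y)`. -/
def brk (n : ℤ) : RatFunc ℚ :=
  ((RatFunc.X : RatFunc ℚ) ^ n - (RatFunc.X : RatFunc ℚ) ^ (-n)) /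
    (RatFunc.X - (RatFunc.X : RatFunc ℚ)⁻¹)

/-- `s(r,e) = (-1)^{e-r(g-1)}·[e-r(g-1)]_y`. -/
def sF (g : ℤ) (γ : ℤ × ℤ) : RatFunc ℚ :=
  (-1 : RatFunc ℚ) ^ (γ.2 - γ.1 * (g - 1)) * brk (γ.2 - γ.1 * (g - 1))

lemma tilde_tilde (g : ℤ) (γ : ℤ × ℤ) : tilde g (tilde g γ) = γ := by
  ext <;> simp [tilde]

lemma tilde_add (g : ℤ) (a b : ℤ × ℤ) : tilde g (a + b) = tilde g a + tilde g b := by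
  ext
  · simp [tilde]
  · simp only [tilde, Prod.fst_add, Prod.snd_add]
    ring

lemma tilde_sum (g : ℤ) {ι : Type*} (s : Finset ι) (f : ι → ℤ × ℤ) :
    tilde g (∑ i ∈ s, f i) = ∑ i ∈ s, tilde g (f i) :=
  map_sum (AddMonoidHom.mk' (tilde g) (tilde_add g)) f s

lemma slopeZ_tilde (g : ℤ) {γ : ℤ × ℤ} (h : 1 ≤ γ.1) :
    slopeZ (tilde g γ) = 2 * (g - 1) - slopeZ γ := by
  have h0 : (γ.1 : ℚ) ≠ 0 := by
    exact_mod_cast (by omega : γ.1 ≠ 0)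
  simp only [slopeZ, tilde]
  push_cast
  field_simp
  ring

lemma slopeZ_tilde_eq_iff (g : ℤ) {a b : ℤ × ℤ} (ha : 1 ≤ a.1) (hb : 1 ≤ b.1) :
    slopeZ (tilde g a) = slopeZ (tilde g b) ↔ slopeZ a = slopeZ b := by
  rw [slopeZ_tilde g ha, slopeZ_tilde g hb, sub_right_inj]

lemma brk_neg (n : ℤ) : brk (-n) = -brk n := by
  simp only [brk, neg_neg]
  rw [← neg_div, neg_sub]

lemma sF_tilde (g : ℤ) (γ : ℤ × ℤ) : sF g (tilde g γ) = -sF g γ := by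
  have h : (tilde g γ).2 - (tilde g γ).1 * (g - 1) = -(γ.2 - γ.1 * (g - 1)) := by
    simp only [tilde]
    ring
  have h1 (n : ℤ) : (-1 : RatFunc ℚ) ^ (-n) = (-1) ^ n := by
    rw [zpow_neg, ← inv_zpow, inv_neg, inv_one]
  rw [sF, h, h1, brk_neg, mul_neg, sF]

/-- `tilde g`, applied to every entry of a tuple. -/
def tildeTuple (g : ℤ) (n : ℕ) :
    ((ℤ × ℤ) × (Fin n → ℤ × ℤ)) ≃ ((ℤ × ℤ) × (Fin n → ℤ × ℤ)) where
  toFun t := (tilde g t.1, fun i => tilde g (t.2 i))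
  invFun t := (tilde g t.1, fun i => tilde g (t.2 i))
  left_inv t := by simp [tilde_tilde]
  right_inv t := by simp [tilde_tilde]

/-- The tuple `t` has positive ranks, sums to `γ`, and all its entries have the slope of `γ`. -/
def IsEqualSlopeTuple {n : ℕ} (γ : ℤ × ℤ) (t : (ℤ × ℤ) × (Fin n → ℤ × ℤ)) : Prop :=
  1 ≤ t.1.1 ∧ (∀ i, 1 ≤ (t.2 i).1) ∧ t.1 + ∑ i, t.2 i = γ ∧
    slopeZ t.1 = slopeZ γ ∧ ∀ i, slopeZ (t.2 i) = slopeZ γ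

lemma isEqualSlopeTuple_tildeTuple_iff (g : ℤ) {n : ℕ} {γ : ℤ × ℤ} (hγ : 1 ≤ γ.1)
    (t : (ℤ × ℤ) × (Fin n → ℤ × ℤ)) :
    IsEqualSlopeTuple (tilde g γ) (tildeTuple g n t) ↔ IsEqualSlopeTuple γ t := by
  refine and_congr_right fun h1 => and_congr_right fun h2 => and_congr ?_ (and_congr ?_ ?_)
  · change tilde g t.1 + ∑ i, tilde g (t.2 i) = _ ↔ _
    rw [← tilde_sum, ← tilde_add]
    exact (Function.LeftInverse.injective (tilde_tilde g)).eq_iff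
  · exact slopeZ_tilde_eq_iff g h1 hγ
  · exact forall_congr' fun i => slopeZ_tilde_eq_iff g (h2 i) hγ

lemma mem_Icc_of_slopeZ_eq {a γ : ℤ × ℤ} (ha : 1 ≤ a.1) (haγ : a.1 ≤ γ.1)
    (h : slopeZ a = slopeZ γ) :
    a ∈ Set.Icc ((1, -(|γ.2| * γ.1)) : ℤ × ℤ) (γ.1, |γ.2| * γ.1) := by
  have h1 : (a.1 : ℚ) ≠ 0 := by exact_mod_cast (by omega : a.1 ≠ 0)
  have h2 : (γ.1 : ℚ) ≠ 0 := by exact_mod_cast (by omega : γ.1 ≠ 0)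
  have h3 : a.2 * γ.1 = γ.2 * a.1 := by
    rw [slopeZ, slopeZ, div_eq_div_iff h1 h2] at h
    exact_mod_cast h
  have h4 : |a.2| * γ.1 = |γ.2| * a.1 := by
    have := congrArg abs h3
    rwa [abs_mul, abs_mul, abs_of_pos (by omega : 0 < γ.1),
      abs_of_pos (by omega : 0 < a.1)] at this
  have h5 : |a.2| ≤ |γ.2| * γ.1 := by
    nlinarith [abs_nonneg a.2, abs_nonneg γ.2]
  rw [abs_le] at h5
  exact ⟨⟨ha, h5.1⟩, ⟨haγ, h5.2⟩⟩

lemma finite_isEqualSlopeTuple (n : ℕ) (γ : ℤ × ℤ) :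
    {t : (ℤ × ℤ) × (Fin n → ℤ × ℤ) | IsEqualSlopeTuple γ t}.Finite := by
  refine (Set.finite_Icc
    (((1, -(|γ.2| * γ.1)), fun _ => (1, -(|γ.2| * γ.1))) : (ℤ × ℤ) × (Fin n → ℤ × ℤ))
    ((γ.1, |γ.2| * γ.1), fun _ => (γ.1, |γ.2| * γ.1))).subset ?_
  rintro t ⟨h1, h2, h3, h4, h5⟩
  have hsum : t.1.1 + ∑ i, (t.2 i).1 = γ.1 := by
    rw [← h3, Prod.fst_add, Prod.fst_sum]
  have hpos (i : Fin n) : 0 ≤ (t.2 i).1 := by linarith [h2 i]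
  have hle (i : Fin n) : (t.2 i).1 ≤ ∑ i, (t.2 i).1 :=
    Finset.single_le_sum (f := fun i => (t.2 i).1) (fun i _ => hpos i) (Finset.mem_univ i)
  have hnonneg : 0 ≤ ∑ i, (t.2 i).1 := Finset.sum_nonneg fun i _ => hpos i
  have hhead := mem_Icc_of_slopeZ_eq h1 (by omega) h4
  have htail (i : Fin n) :=
    mem_Icc_of_slopeZ_eq (h2 i) (by linarith [hle i]) (h5 i)
  exact ⟨⟨hhead.1, fun i => (htail i).1⟩, ⟨hhead.2, fun i => (htail i).2⟩⟩

/-- if `H(γ) = H(γ̃)` for all `γ`, then for any `γ = (r,e)` and `l ≥ 2`,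
the sum of `B(γ̃₁)·∏_{i=2}^l s(γ_i)H(γ_i)` over ordered tuples `(γ₁,…,γ_l)` in
`ℤ_{≥1} × ℤ` with `γ₁+⋯+γ_l = γ` and `μ(γ_i) = μ(γ)` for all `i`, equals `(-1)^{l-1}`
times the corresponding sum of `B(γ₁)·∏_{i=2}^l s(γ_i)H(γ_i)` over tuples summing to
`γ̃` with all slopes `μ(γ̃)`; moreover both index sets are finite.
A tuple `(γ₁,…,γ_l)` is encoded as a pair `t = (γ₁, (γ₂,…,γ_l)) : (ℤ×ℤ) × (Fin (l-1) → ℤ×ℤ)`. -/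
theorem stmt_2 (g : ℤ) (hg : 2 ≤ g) (B H : ℤ × ℤ → RatFunc ℚ)
    (hH : ∀ γ' : ℤ × ℤ, 1 ≤ γ'.1 → H γ' = H (tilde g γ'))
    (r e : ℤ) (hr : 1 ≤ r) (l : ℕ) (hl : 2 ≤ l) :
    ({t : (ℤ × ℤ) × (Fin (l - 1) → ℤ × ℤ) |
        1 ≤ t.1.1 ∧ (∀ i, 1 ≤ (t.2 i).1) ∧ t.1 + ∑ i, t.2 i = (r, e) ∧
        slopeZ t.1 = slopeZ (r, e) ∧ ∀ i, slopeZ (t.2 i) = slopeZ (r, e)}.Finite ∧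
      {t : (ℤ × ℤ) × (Fin (l - 1) → ℤ × ℤ) |
        1 ≤ t.1.1 ∧ (∀ i, 1 ≤ (t.2 i).1) ∧ t.1 + ∑ i, t.2 i = tilde g (r, e) ∧
        slopeZ t.1 = slopeZ (tilde g (r, e)) ∧
        ∀ i, slopeZ (t.2 i) = slopeZ (tilde g (r, e))}.Finite) ∧
    (∑ᶠ t : (ℤ × ℤ) × (Fin (l - 1) → ℤ × ℤ),
        if 1 ≤ t.1.1 ∧ (∀ i, 1 ≤ (t.2 i).1) ∧ t.1 + ∑ i, t.2 i = (r, e) ∧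
            slopeZ t.1 = slopeZ (r, e) ∧ (∀ i, slopeZ (t.2 i) = slopeZ (r, e)) then
          B (tilde g t.1) * ∏ i, (sF g (t.2 i) * H (t.2 i))
        else 0) =
      (-1 : RatFunc ℚ) ^ (l - 1) *
        ∑ᶠ t : (ℤ × ℤ) × (Fin (l - 1) → ℤ × ℤ),
          if 1 ≤ t.1.1 ∧ (∀ i, 1 ≤ (t.2 i).1) ∧ t.1 + ∑ i, t.2 i = tilde g (r, e) ∧
              slopeZ t.1 = slopeZ (tilde g (r, e)) ∧
              (∀ i, slopeZ (t.2 i) = slopeZ (tilde g (r, e))) then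
            B t.1 * ∏ i, (sF g (t.2 i) * H (t.2 i))
          else 0 := by
  refine ⟨⟨finite_isEqualSlopeTuple _ _, finite_isEqualSlopeTuple _ _⟩, ?_⟩
  rw [← smul_eq_mul, smul_finsum]
  refine Eq.trans (finsum_congr fun t => ?_) (finsum_comp_equiv (tildeTuple g (l - 1)))
  rw [smul_ite, smul_zero]
  refine ite_congr (propext (isEqualSlopeTuple_tildeTuple_iff g (γ := (r, e)) hr t).symm)
    (fun h => ?_) fun _ => rfl
  have hpos (i : Fin (l - 1)) : 1 ≤ (t.2 i).1 := h.2.1 i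
  change _ = (-1) ^ (l - 1) * (B (tilde g t.1) *
    ∏ i, (sF g (tilde g (t.2 i)) * H (tilde g (t.2 i))))
  have hprod : ∏ i, (sF g (tilde g (t.2 i)) * H (tilde g (t.2 i))) =
      (-1) ^ (l - 1) * ∏ i, (sF g (t.2 i) * H (t.2 i)) := by
    simp_rw [sF_tilde, ← hH _ (hpos _), neg_mul, Finset.prod_neg, Finset.card_univ,
      Fintype.card_fin]
  rw [hprod, mul_left_comm (B _), ← mul_assoc, ← mul_pow, neg_one_mul, neg_neg, one_pow, one_mul]

end
end

section
/- Fix integers g ≥ 2, p ≥ 0 and a Young diagram Y. In the field ℚ(λ, y, Q), substitute q_1 = λ^{−1}y, q_2 = λy, w = y^{−1} into Z_Y(q_1,q_2,Q,w) as defined in the context. Then, regarded as a rational function of Q over ℚ(λ,y), the product Q^{(g−1)|Y|} · Z_Y(λ^{−1}y, λy, Q, y^{−1}) is regular at Q = 0, and y^{2|Y|} λ^{(g−1)|Y|} times its value at Q = 0 equals Ω^{(g,p)}_Y(λ,y) := (−1)^{p|Y|} · y^{ −p·Σ_{(i,j)∈Y}(i+j−2) + (g−1)·Σ_{(i,j)∈Y}(−2i+2j+1−2Y_i+Y^t_j)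 } · λ^{ −p·Σ_{(i,j)∈Y}(−i+j) + (g−1)·Σ_{(i,j)∈Y}(2i+2j−1−2Y_i−Y^t_j) } · ∏_{(i,j)∈Y} F( λ^{−i−j+Y_i+Y^t_j+1} · y^{i−j+Y_i−Y^t_j}, y ), where F(q,z) := z^{1−g}(1−q)^{2g}/((1−qz)(1−qz^{−1})). -/
noncomputable section

/-- The rational function `r` is regular at `0`, with value `v` there. -/
def HasValueAtZero {K : Type*} [Field K] (r : RatFunc K) (v : K) : Prop :=
  ∃ f : PowerSeries K, (r : LaurentSeries K) = HahnSeries.ofPowerSeries ℤ K f ∧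
    PowerSeries.constantCoeff f = v

namespace HasValueAtZero

variable {K : Type*} [Field K] {r s : RatFunc K} {u v : K}

lemma const (a : K) : HasValueAtZero (RatFunc.C a) a :=
  ⟨PowerSeries.C a, by
    rw [← Polynomial.coe_C, RatFunc.coe_coe]
    simp, by simp⟩

lemma X : HasValueAtZero (RatFunc.X : RatFunc K) 0 :=
  ⟨PowerSeries.X, by simp, by simp⟩

lemma one : HasValueAtZero (1 : RatFunc K) 1 := ⟨1, by simp, by simp⟩

lemma mul (hr : HasValueAtZero r u) (hs : HasValueAtZero s v) :
    HasValueAtZero (r * s) (u * v) := by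
  obtain ⟨f, hf, rfl⟩ := hr
  obtain ⟨h, hh, rfl⟩ := hs
  exact ⟨f * h, by rw [map_mul, map_mul, hf, hh], by simp⟩

lemma sub (hr : HasValueAtZero r u) (hs : HasValueAtZero s v) :
    HasValueAtZero (r - s) (u - v) := by
  obtain ⟨f, hf, rfl⟩ := hr
  obtain ⟨h, hh, rfl⟩ := hs
  exact ⟨f - h, by rw [map_sub, map_sub, hf, hh], by simp⟩

lemma pow (hr : HasValueAtZero r u) (n : ℕ) : HasValueAtZero (r ^ n) (u ^ n) := by
  obtain ⟨f, hf, rfl⟩ := hr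
  exact ⟨f ^ n, by rw [map_pow, map_pow, hf], by simp⟩

lemma inv (hr : HasValueAtZero r u) (hu : u ≠ 0) : HasValueAtZero r⁻¹ u⁻¹ := by
  obtain ⟨f, hf, rfl⟩ := hr
  refine ⟨f⁻¹, ?_, by simp⟩
  rw [map_inv₀, hf]
  refine (eq_inv_of_mul_eq_one_left ?_).symm
  rw [← map_mul, PowerSeries.inv_mul_cancel f hu, map_one]

lemma div (hr : HasValueAtZero r u) (hs : HasValueAtZero s v) (hv : v ≠ 0) :
    HasValueAtZero (r / s) (u / v) := by
  simpa only [div_eq_mul_inv] using hr.mul (hs.inv hv)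

lemma prod {ι : Type*} (t : Finset ι) {f : ι → RatFunc K} {a : ι → K}
    (h : ∀ i ∈ t, HasValueAtZero (f i) (a i)) :
    HasValueAtZero (∏ i ∈ t, f i) (∏ i ∈ t, a i) := by
  classical
  induction t using Finset.induction_on with
  | empty => simpa using one
  | insert i t hi ih =>
    rw [Finset.prod_insert hi, Finset.prod_insert hi]
    exact (h i (Finset.mem_insert_self i t)).mul
      (ih fun j hj => h j (Finset.mem_insert_of_mem hj))

lemma coeff_of_neg (h : HasValueAtZero r v) {n : ℤ} (hn : n < 0) :
    (r : LaurentSeries K).coeff n = 0 := by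
  obtain ⟨f, hf, -⟩ := h
  rw [hf, PowerSeries.coeff_coe, if_pos hn]

lemma coeff_zero (h : HasValueAtZero r v) : (r : LaurentSeries K).coeff 0 = v := by
  obtain ⟨f, hf, rfl⟩ := h
  rw [hf, PowerSeries.coeff_coe]
  simp

lemma one_sub_X_factor (a b : K) (g : ℕ) :
    HasValueAtZero
      ((1 - RatFunc.C a * RatFunc.X) ^ g / (1 - RatFunc.C b * RatFunc.X)) 1 := by
  have h (c : K) : HasValueAtZero (1 - RatFunc.C c * RatFunc.X) 1 := by
    simpa using one.sub ((const c).mul X)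
  simpa using ((h a).pow g).div (h b) one_ne_zero

lemma one_sub_X_inv_factor (a : K) {b : K} (hb : b ≠ 0) (n : ℕ) :
    HasValueAtZero
      (RatFunc.X ^ n * ((1 - RatFunc.C a * RatFunc.X⁻¹) ^ (n + 1) /
        (1 - RatFunc.C b * RatFunc.X⁻¹))) ((-a) ^ (n + 1) / (-b)) := by
  have h (c : K) : HasValueAtZero (RatFunc.X - RatFunc.C c) (-c) := by
    simpa using X.sub (const c)
  have hX (c : K) : (1 - RatFunc.C c * RatFunc.X⁻¹ : RatFunc K) =
      (RatFunc.X - RatFunc.C c) / RatFunc.X := by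
    rw [sub_div, div_self RatFunc.X_ne_zero, div_eq_mul_inv]
  have hX0 : (RatFunc.X : RatFunc K) ≠ 0 := RatFunc.X_ne_zero
  convert ((h a).pow (n + 1)).div (h b) (neg_ne_zero.mpr hb) using 1
  rw [hX, hX, div_pow, div_div_div_eq, pow_succ RatFunc.X n, mul_div_assoc',
    mul_assoc (RatFunc.X ^ n), mul_comm RatFunc.X (RatFunc.X - RatFunc.C b), mul_left_comm,
    ← mul_assoc]
  field_simp

end HasValueAtZero

/-- The exponential `n ↦ a ^ n` turns finite sums of integers into products. -/
lemma zpow_finset_sum {K ι : Type*} [Field K] {a : K} (ha : a ≠ 0) (t : Finset ι) (f : ι → ℤ) :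
    a ^ (∑ i ∈ t, f i) = ∏ i ∈ t, a ^ f i := by
  classical
  induction t using Finset.induction_on with
  | empty => simp
  | insert i t hi ih => rw [Finset.sum_insert hi, Finset.prod_insert hi, zpow_add₀ ha, ih]

section Box

variable {K : Type*} [Field K] {y l : K}

lemma zpow_mul_zpow_weights (hy : y ≠ 0) (hl : l ≠ 0) (m n : ℤ) :
    (l⁻¹ * y) ^ m * (l * y) ^ n = l ^ (n - m) * y ^ (m + n) := by
  rw [mul_zpow, mul_zpow, inv_zpow', zpow_add₀ hy, sub_eq_add_neg, zpow_add₀ hl]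
  ring

/-- Two factors of weights `q`, `q⁻¹`, with `w = y⁻¹`, combine into the genus-`g` vertex `F`. -/
lemma vertex_factor (hy : y ≠ 0) {q : K} (hq : q ≠ 0) (n : ℕ) :
    (1 - q) ^ (n + 1) / (1 - q * y) * ((1 - q⁻¹) ^ (n + 1) / (1 - q⁻¹ * y)) =
      (-1) ^ n * q ^ (-(n : ℤ)) * y⁻¹ *
        ((1 - q) ^ (2 * (n + 1)) / ((1 - q * y) * (1 - q * y⁻¹))) := by
  have h1 : 1 - q⁻¹ = -q⁻¹ * (1 - q) := by field_simp; ring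
  have h2 : 1 - q⁻¹ * y = -(q⁻¹ * y) * (1 - q * y⁻¹) := by field_simp; ring
  rw [h1, h2, mul_pow, neg_pow, zpow_neg, zpow_natCast, div_mul_div_comm,
    mul_left_comm (1 - q * y), div_eq_mul_inv, div_eq_mul_inv, mul_inv (-(q⁻¹ * y)),
    ← neg_inv, mul_inv, inv_inv, inv_pow]
  field_simp
  ring

/-- The contribution of a box at `(i, j)`, in a row of length `a` and a column of length `b`, to
`Q ^ (n * |Y|) * Z_Y`, where `n = g - 1` and `Q` is the variable of `RatFunc K`. -/
def boxFactor (y l : K) (n p i j : ℕ) (a b : ℤ) : RatFunc K :=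
  (-1) ^ p *
  (RatFunc.C (l⁻¹ * y) ^ (-(p : ℤ) * i) * RatFunc.C (l * y) ^ (-(p : ℤ) * j)) *
  ((1 - RatFunc.C y⁻¹ * RatFunc.C (l⁻¹ * y) ^ (-(b - i - 1)) *
      RatFunc.C (l * y) ^ (a - j)) ^ (n + 1) /
    (1 - RatFunc.C (l⁻¹ * y) ^ (-(b - i - 1)) * RatFunc.C (l * y) ^ (a - j))) *
  ((1 - RatFunc.C y⁻¹ * RatFunc.C (l⁻¹ * y) ^ (b - i) *
      RatFunc.C (l * y) ^ (-(a - j - 1))) ^ (n + 1) /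
    (1 - RatFunc.C (l⁻¹ * y) ^ (b - i) * RatFunc.C (l * y) ^ (-(a - j - 1)))) *
  ((1 - RatFunc.C y⁻¹ * RatFunc.X * RatFunc.C (l⁻¹ * y) ^ ((i : ℤ) + 1) *
      RatFunc.C (l * y) ^ (a - j)) ^ (n + 1) /
    (1 - RatFunc.X * RatFunc.C (l⁻¹ * y) ^ ((i : ℤ) + 1) * RatFunc.C (l * y) ^ (a - j))) *
  (RatFunc.X ^ n *
    ((1 - RatFunc.C y⁻¹ * RatFunc.X⁻¹ * RatFunc.C (l⁻¹ * y) ^ (-(i : ℤ)) *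
        RatFunc.C (l * y) ^ (-(a - j - 1))) ^ (n + 1) /
      (1 - RatFunc.X⁻¹ * RatFunc.C (l⁻¹ * y) ^ (-(i : ℤ)) *
        RatFunc.C (l * y) ^ (-(a - j - 1)))))

/-- The contribution of a box to `Ω_Y`, with the conventions of `boxFactor`. -/
def boxOmega (y l : K) (n p i j : ℕ) (a b : ℤ) : K :=
  (-1) ^ p *
  y ^ (-(p : ℤ) * ((i : ℤ) + j) + n * (-2 * (i : ℤ) + 2 * j + 1 - 2 * a + b)) *
  l ^ (-(p : ℤ) * ((j : ℤ) - i) + n * (2 * (i : ℤ) + 2 * j + 3 - 2 * a - b)) *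
  (y ^ (-(n : ℤ)) * (1 - l ^ (a + b - i - j - 1) * y ^ ((i : ℤ) - j + a - b)) ^ (2 * (n + 1)) /
    ((1 - l ^ (a + b - i - j - 1) * y ^ ((i : ℤ) - j + a - b) * y) *
      (1 - l ^ (a + b - i - j - 1) * y ^ ((i : ℤ) - j + a - b) * y⁻¹)))

lemma hasValueAtZero_boxFactor (hy : y ≠ 0) (hl : l ≠ 0) (n p i j : ℕ) (a b : ℤ) :
    HasValueAtZero (boxFactor y l n p i j a b)
      ((y ^ 2 * l ^ n)⁻¹ * boxOmega y l n p i j a b) := by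
  obtain ⟨q, hq⟩ : ∃ q, q = l ^ (a + b - i - j - 1) * y ^ ((i : ℤ) - j + a - b) := ⟨_, rfl⟩
  obtain ⟨A, hA⟩ : ∃ A, A = l ^ (i - a + j + 1) * y ^ (-(i : ℤ) - a + j + 1) := ⟨_, rfl⟩
  have hq0 : q ≠ 0 := hq ▸ mul_ne_zero (zpow_ne_zero _ hl) (zpow_ne_zero _ hy)
  have hA0 : A ≠ 0 := hA ▸ mul_ne_zero (zpow_ne_zero _ hl) (zpow_ne_zero _ hy)
  have hC (m k : ℤ) : (RatFunc.C (l⁻¹ * y) ^ m * RatFunc.C (l * y) ^ k : RatFunc K) =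
      RatFunc.C (l ^ (k - m) * y ^ (m + k)) := by
    rw [← map_zpow₀, ← map_zpow₀, ← map_mul, zpow_mul_zpow_weights hy hl]
  have e1 : l ^ (a - j - -(b - i - 1)) * y ^ (-(b - i - 1) + (a - j)) = q * y := by
    rw [hq, mul_assoc, ← zpow_add_one₀ hy]
    congr 2 <;> ring
  have e2 : l ^ (-(a - j - 1) - (b - i)) * y ^ (b - i + -(a - j - 1)) = q⁻¹ * y := by
    rw [hq, mul_inv, ← zpow_neg, ← zpow_neg, mul_assoc, ← zpow_add_one₀ hy]
    congr 2 <;> ring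
  have e4 : l ^ (-(a - j - 1) - -(i : ℤ)) * y ^ (-(i : ℤ) + -(a - j - 1)) = A := by
    rw [hA]
    congr 2 <;> ring
  have hconst : HasValueAtZero (RatFunc.C
      ((-1) ^ p * (l ^ (-(p : ℤ) * j - -(p : ℤ) * i) * y ^ (-(p : ℤ) * i + -(p : ℤ) * j)) *
        ((1 - q) ^ (n + 1) / (1 - q * y)) * ((1 - q⁻¹) ^ (n + 1) / (1 - q⁻¹ * y)))) _ :=
    HasValueAtZero.const _
  have hX := HasValueAtZero.one_sub_X_factor
    (y⁻¹ * (l ^ (a - j - ((i : ℤ) + 1)) * y ^ ((i : ℤ) + 1 + (a - j))))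
    (l ^ (a - j - ((i : ℤ) + 1)) * y ^ ((i : ℤ) + 1 + (a - j))) (n + 1)
  have hXi := HasValueAtZero.one_sub_X_inv_factor (y⁻¹ * A) hA0 n
  convert (hconst.mul hX).mul hXi using 1
  · have c1 : y⁻¹ * (q * y) = q := by field_simp
    have c2 : y⁻¹ * (q⁻¹ * y) = q⁻¹ := by field_simp
    unfold boxFactor
    simp only [mul_assoc (RatFunc.C y⁻¹), mul_assoc RatFunc.X, mul_assoc RatFunc.X⁻¹, hC, e1, e2,
      e4]
    simp only [mul_left_comm (RatFunc.C y⁻¹), mul_comm RatFunc.X, mul_comm RatFunc.X⁻¹, ← map_mul]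
    simp only [c1, c2, mul_comm y⁻¹, map_mul, map_sub, map_pow, map_div₀, map_one, map_neg]
    simp only [mul_assoc]
  · rw [mul_assoc ((-1) ^ p * _), vertex_factor hy hq0]
    unfold boxOmega
    rw [← hq]
    have hAn : (-(y⁻¹ * A)) ^ (n + 1) / (-A) =
        (-1) ^ n * y ^ (-(n : ℤ) - 1) *
          (l ^ (n * (i - a + j + 1)) * y ^ (n * (-(i : ℤ) - a + j + 1))) := by
      have hA' : l ^ (n * (i - a + j + 1)) * y ^ (n * (-(i : ℤ) - a + j + 1)) = A ^ n := by
        rw [hA, mul_pow, ← zpow_natCast, ← zpow_natCast, ← zpow_mul, ← zpow_mul]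
        congr 2 <;> ring
      rw [hA', zpow_sub_one₀ hy, zpow_neg, zpow_natCast, neg_pow, mul_pow, inv_pow]
      field_simp
      ring
    have hqn : q ^ (-(n : ℤ)) = l ^ (-(n : ℤ) * (a + b - i - j - 1)) *
        y ^ (-(n : ℤ) * ((i : ℤ) - j + a - b)) := by
      rw [hq, mul_zpow, ← zpow_mul, ← zpow_mul]
      congr 2 <;> ring
    have hsign : ((-1 : K) ^ n) * (-1) ^ n = 1 := by rw [← mul_pow]; simp
    have hyE : (y ^ 2)⁻¹ * y ^ (-(p : ℤ) * ((i : ℤ) + j) +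
          n * (-2 * (i : ℤ) + 2 * j + 1 - 2 * a + b)) * y ^ (-(n : ℤ)) =
        y ^ (-(p : ℤ) * i + -(p : ℤ) * j) * y ^ (-(n : ℤ) * ((i : ℤ) - j + a - b)) * y⁻¹ *
          (y ^ (-(n : ℤ) - 1) * y ^ (n * (-(i : ℤ) - a + j + 1))) := by
      rw [← zpow_natCast, ← zpow_neg, ← zpow_neg_one]
      simp only [← zpow_add₀ hy]
      congr 1
      push_cast
      ring
    have hlE : (l ^ n)⁻¹ * l ^ (-(p : ℤ) * ((j : ℤ) - i) +
          n * (2 * (i : ℤ) + 2 * j + 3 - 2 * a - b)) =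
        l ^ (-(p : ℤ) * j - -(p : ℤ) * i) * l ^ (-(n : ℤ) * (a + b - i - j - 1)) *
          l ^ (n * (i - a + j + 1)) := by
      rw [← zpow_natCast, ← zpow_neg]
      simp only [← zpow_add₀ hl]
      congr 1
      ring
    rw [hAn, hqn, mul_inv]
    generalize (1 - q) ^ (2 * (n + 1)) = N
    generalize (1 - q * y) * (1 - q * y⁻¹) = D
    rw [mul_div_assoc]
    generalize N / D = R
    have hcomb := congr_arg₂ (· * ·) (congr_arg₂ (· * ·) hyE hlE) hsign.symm
    linear_combination (-1) ^ p * R * hcomb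

end Box

lemma prod_boxOmega {K : Type*} [Field K] {y l : K} (hy : y ≠ 0) (hl : l ≠ 0) (n p : ℕ)
    (t : Finset (ℕ × ℕ)) (a b : ℕ × ℕ → ℤ) :
    ∏ c ∈ t, boxOmega y l n p c.1 c.2 (a c) (b c) =
      (-1) ^ (p * t.card) *
      y ^ (-(p : ℤ) * (∑ c ∈ t, ((c.1 : ℤ) + (c.2 : ℤ))) +
        n * (∑ c ∈ t, (-2 * (c.1 : ℤ) + 2 * (c.2 : ℤ) + 1 - 2 * a c + b c))) *
      l ^ (-(p : ℤ) * (∑ c ∈ t, ((c.2 : ℤ) - (c.1 : ℤ))) +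
        n * (∑ c ∈ t, (2 * (c.1 : ℤ) + 2 * (c.2 : ℤ) + 3 - 2 * a c - b c))) *
      ∏ c ∈ t, (y ^ (-(n : ℤ)) *
          (1 - l ^ (a c + b c - c.1 - c.2 - 1) * y ^ ((c.1 : ℤ) - c.2 + a c - b c)) ^
            (2 * (n + 1)) /
        ((1 - l ^ (a c + b c - c.1 - c.2 - 1) * y ^ ((c.1 : ℤ) - c.2 + a c - b c) * y) *
          (1 - l ^ (a c + b c - c.1 - c.2 - 1) * y ^ ((c.1 : ℤ) - c.2 + a c - b c) * y⁻¹))) := by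
  simp only [Finset.mul_sum, ← Finset.sum_add_distrib]
  rw [zpow_finset_sum hy, zpow_finset_sum hl, pow_mul, ← Finset.prod_const,
    ← Finset.prod_mul_distrib, ← Finset.prod_mul_distrib, ← Finset.prod_mul_distrib]
  rfl

lemma prod_boxFactor {K : Type*} [Field K] (y l : K) (n p : ℕ)
    (t : Finset (ℕ × ℕ)) (a b : ℕ × ℕ → ℤ) :
    ∏ c ∈ t, boxFactor y l n p c.1 c.2 (a c) (b c) =
      RatFunc.X ^ (n * t.card) *
      ((-1) ^ (p * t.card) *
      (∏ c ∈ t, RatFunc.C (l⁻¹ * y) ^ (-(p : ℤ) * c.1) *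
        RatFunc.C (l * y) ^ (-(p : ℤ) * c.2)) *
      (∏ c ∈ t,
        (1 - RatFunc.C y⁻¹ * RatFunc.C (l⁻¹ * y) ^ (-(b c - c.1 - 1)) *
            RatFunc.C (l * y) ^ (a c - c.2)) ^ (n + 1) /
          (1 - RatFunc.C (l⁻¹ * y) ^ (-(b c - c.1 - 1)) * RatFunc.C (l * y) ^ (a c - c.2))) *
      (∏ c ∈ t,
        (1 - RatFunc.C y⁻¹ * RatFunc.C (l⁻¹ * y) ^ (b c - c.1) *
            RatFunc.C (l * y) ^ (-(a c - c.2 - 1))) ^ (n + 1) /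
          (1 - RatFunc.C (l⁻¹ * y) ^ (b c - c.1) * RatFunc.C (l * y) ^ (-(a c - c.2 - 1)))) *
      (∏ c ∈ t,
        (1 - RatFunc.C y⁻¹ * RatFunc.X * RatFunc.C (l⁻¹ * y) ^ ((c.1 : ℤ) + 1) *
            RatFunc.C (l * y) ^ (a c - c.2)) ^ (n + 1) /
          (1 - RatFunc.X * RatFunc.C (l⁻¹ * y) ^ ((c.1 : ℤ) + 1) *
            RatFunc.C (l * y) ^ (a c - c.2))) *
      (∏ c ∈ t,
        (1 - RatFunc.C y⁻¹ * RatFunc.X⁻¹ * RatFunc.C (l⁻¹ * y) ^ (-(c.1 : ℤ)) *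
            RatFunc.C (l * y) ^ (-(a c - c.2 - 1))) ^ (n + 1) /
          (1 - RatFunc.X⁻¹ * RatFunc.C (l⁻¹ * y) ^ (-(c.1 : ℤ)) *
            RatFunc.C (l * y) ^ (-(a c - c.2 - 1))))) := by
  unfold boxFactor
  simp only [Finset.prod_mul_distrib, Finset.prod_const, ← pow_mul]
  rw [mul_left_comm]

/-- the equivariant fixed-point factor `Z_Y(q₁,q₂,Q,w)` of the moduli
of framed sheaves on `ℙ²` at the fixed point `(Y,∅)`, after the substitutions
`q₁ = λ⁻¹y`, `q₂ = λy`, `w = y⁻¹`, and multiplied by `Q^{(g-1)|Y|}`, is regular at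
`Q = 0` (its Laurent expansion in `Q` has no negative coefficients), and
`y^{2|Y|}λ^{(g-1)|Y|}` times its value at `Q = 0` equals `Ω^{(g,p)}_Y(λ,y)`.
Here `ℚ(λ,y)` is realized as `RatFunc (RatFunc ℚ)` (with inner variable `y` and outer
variable `λ`), the variable `Q` is adjoined as `RatFunc.X` of a further `RatFunc`,
boxes of `Y` are 0-indexed (the paper's `(i,j)` is `c = (c.1+1, c.2+1)`,
`Y_i = rowLen c.1`, `Y^t_j = colLen c.2`), and
`F(q,z) = z^{1-g}(1-q)^{2g}/((1-qz)(1-qz⁻¹))`. -/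
theorem stmt_12 (g p : ℕ) (hg : 2 ≤ g) (Y : YoungDiagram) :
    let Kxy := RatFunc (RatFunc ℚ)
    let yy : Kxy := RatFunc.C RatFunc.X
    let lam : Kxy := RatFunc.X
    let Q : RatFunc Kxy := RatFunc.X
    let CF : Kxy →+* RatFunc Kxy := RatFunc.C
    let q1 : RatFunc Kxy := CF (lam⁻¹ * yy)
    let q2 : RatFunc Kxy := CF (lam * yy)
    let w : RatFunc Kxy := CF yy⁻¹
    let ZY : RatFunc Kxy :=
      (-1 : RatFunc Kxy) ^ (p * Y.cells.card) *
      (∏ c ∈ Y.cells, q1 ^ (-(p : ℤ) * c.1) * q2 ^ (-(p : ℤ) * c.2)) *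
      (∏ c ∈ Y.cells,
        (1 - w * q1 ^ (-((Y.colLen c.2 : ℤ) - c.1 - 1)) *
            q2 ^ ((Y.rowLen c.1 : ℤ) - c.2)) ^ g /
          (1 - q1 ^ (-((Y.colLen c.2 : ℤ) - c.1 - 1)) *
            q2 ^ ((Y.rowLen c.1 : ℤ) - c.2))) *
      (∏ c ∈ Y.cells,
        (1 - w * q1 ^ ((Y.colLen c.2 : ℤ) - c.1) *
            q2 ^ (-((Y.rowLen c.1 : ℤ) - c.2 - 1))) ^ g /
          (1 - q1 ^ ((Y.colLen c.2 : ℤ) - c.1) *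
            q2 ^ (-((Y.rowLen c.1 : ℤ) - c.2 - 1)))) *
      (∏ c ∈ Y.cells,
        (1 - w * Q * q1 ^ ((c.1 : ℤ) + 1) * q2 ^ ((Y.rowLen c.1 : ℤ) - c.2)) ^ g /
          (1 - Q * q1 ^ ((c.1 : ℤ) + 1) * q2 ^ ((Y.rowLen c.1 : ℤ) - c.2))) *
      (∏ c ∈ Y.cells,
        (1 - w * Q⁻¹ * q1 ^ (-(c.1 : ℤ)) *
            q2 ^ (-((Y.rowLen c.1 : ℤ) - c.2 - 1))) ^ g /
          (1 - Q⁻¹ * q1 ^ (-(c.1 : ℤ)) *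
            q2 ^ (-((Y.rowLen c.1 : ℤ) - c.2 - 1))))
    let W : RatFunc Kxy := Q ^ ((g - 1) * Y.cells.card) * ZY
    let Ffun : Kxy → Kxy → Kxy := fun q z =>
      z ^ (1 - (g : ℤ)) * (1 - q) ^ (2 * g) / ((1 - q * z) * (1 - q * z⁻¹))
    let Ω : Kxy :=
      (-1 : Kxy) ^ (p * Y.cells.card) *
      yy ^ (-(p : ℤ) * (∑ c ∈ Y.cells, ((c.1 : ℤ) + (c.2 : ℤ))) +
        ((g : ℤ) - 1) * (∑ c ∈ Y.cells,
          (-2 * (c.1 : ℤ) + 2 * (c.2 : ℤ) + 1 - 2 * (Y.rowLen c.1 : ℤ) +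
            (Y.colLen c.2 : ℤ)))) *
      lam ^ (-(p : ℤ) * (∑ c ∈ Y.cells, ((c.2 : ℤ) - (c.1 : ℤ))) +
        ((g : ℤ) - 1) * (∑ c ∈ Y.cells,
          (2 * (c.1 : ℤ) + 2 * (c.2 : ℤ) + 3 - 2 * (Y.rowLen c.1 : ℤ) -
            (Y.colLen c.2 : ℤ)))) *
      ∏ c ∈ Y.cells,
        Ffun (lam ^ ((Y.rowLen c.1 : ℤ) + (Y.colLen c.2 : ℤ) - c.1 - c.2 - 1) *
              yy ^ ((c.1 : ℤ) - c.2 + (Y.rowLen c.1 : ℤ) - (Y.colLen c.2 : ℤ)))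
          yy
    (∀ n : ℤ, n < 0 → (↑W : LaurentSeries Kxy).coeff n = 0) ∧
      yy ^ (2 * Y.cells.card) * lam ^ ((g - 1) * Y.cells.card) *
          (↑W : LaurentSeries Kxy).coeff 0 = Ω := by
  intro Kxy yy lam Q CF q1 q2 w ZY W Ffun Ω
  obtain ⟨n, rfl⟩ : ∃ n, g = n + 1 := ⟨g - 1, by omega⟩
  have hy : yy ≠ 0 := (map_ne_zero _).mpr RatFunc.X_ne_zero
  have hl : lam ≠ 0 := RatFunc.X_ne_zero
  have hn : ((n + 1 : ℕ) : ℤ) - 1 = n := by push_cast; ring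
  have hn' : 1 - ((n + 1 : ℕ) : ℤ) = -n := by push_cast; ring
  have hW : W = ∏ c ∈ Y.cells, boxFactor yy lam n p c.1 c.2 (Y.rowLen c.1) (Y.colLen c.2) :=
    (prod_boxFactor yy lam n p Y.cells (fun c => Y.rowLen c.1) (fun c => Y.colLen c.2)).symm
  have hΩ : Ω = ∏ c ∈ Y.cells, boxOmega yy lam n p c.1 c.2 (Y.rowLen c.1) (Y.colLen c.2) := by
    rw [prod_boxOmega hy hl n p Y.cells (fun c => Y.rowLen c.1) (fun c => Y.colLen c.2)]
    simp only [Ω, Ffun, hn, hn']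
  have hval := HasValueAtZero.prod Y.cells fun c _ =>
    hasValueAtZero_boxFactor hy hl n p c.1 c.2 (Y.rowLen c.1) (Y.colLen c.2)
  rw [← hW, Finset.prod_mul_distrib, ← hΩ, Finset.prod_const] at hval
  refine ⟨fun m hm => hval.coeff_of_neg hm, ?_⟩
  rw [hval.coeff_zero, Nat.add_sub_cancel, pow_mul, pow_mul, ← mul_pow, inv_pow,
    mul_inv_cancel_left₀ (pow_ne_zero _ (mul_ne_zero (pow_ne_zero _ hy) (pow_ne_zero _ hl)))]

end
end

section
/- Let g = 2, p = 0. Define Ã_1(e), Ã_2(e) ∈ ℚ(y) and H̃_1 = (1−y)^4/y³ as follows: Ã_1(e) is the coefficient of λ^e in the power series expansion of y^{−1}(1−λ)^4/((1−λy)(1−λy^{−1})); Ã_2(e) is the coefficient of λ^e in the formal Laurent expansion of Ω_{(1,1)} + Ω_{(2)}, where Ω_{(1,1)} := y^{−2}(1−λ²y^{−1})^4(1−λ)^4/((1−λ²)(1−λ²y^{−2})(1−λy)(1−λy^{−1})) and Ω_{(2)} := λ^{−2}y^{−4}(1−λ²y)^4(1−λ)^4/((1−λ²)(1−λ²y²)(1−λy)(1−λy^{−1})).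 Then in ℚ(y): Ã_2(0) − Ã_2(4) + (y² + 1 + y^{−2})·Ã_1(0)·H̃_1 + (y + y^{−1})·Ã_1(1)·H̃_1 + Ã_1(2)·H̃_1 − (1/2)·H̃_1² = −(y + y^{−1}) · (1−y)^4(2 + 4y² − 8y³ + 7y⁴ − 12y⁵ + 14y⁶ − 4y⁷ + 5y⁸)/(2y⁹(1+y²)). (Equivalently, the rank-two even-degree recursion [−2]_y·H̃(2,0) = Ã_2(0) − Ã_2(4) + Σ_{e_1=0}^{2}Ã_1(e_1)[3−e_1]_y H̃_1 − (1/2)[−1]_y² H̃_1² has the unique solution H̃(2,0) = (1−y)^4(2+4y²−8y³+7y⁴−12y⁵+14y⁶−4y⁷+5y⁸)/(2y⁹(1+y²)).) -/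
noncomputable section

/-- The `λⁿ`-coefficient of the formal Laurent expansion (at `λ = 0`) of a rational
function of `λ` over `ℚ(y)`. -/
def lcoeff (f : RatFunc (RatFunc ℚ)) (n : ℤ) : RatFunc ℚ :=
  (↑f : LaurentSeries (RatFunc ℚ)).coeff n

namespace PowerSeries

variable {K : Type*} [Field K]

theorem coeff_mul_one_sub_X_pow_mul_C (t : PowerSeries K) (c : K) (k n : ℕ) :
    coeff n (t * (1 - X ^ k * C c)) =
      coeff n t - if k ≤ n then coeff (n - k) t * c else 0 := by
  rw [mul_sub, mul_one, ← mul_assoc, map_sub, coeff_mul_C, coeff_mul_X_pow', ite_mul, zero_mul]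

theorem constantCoeff_one_sub_X_pow_mul_C_ne_zero (c : K) {k : ℕ} (hk : k ≠ 0) :
    constantCoeff (1 - X ^ k * C c) ≠ 0 := by
  simp [hk]

theorem coeff_mul_inv_one_sub_X_pow_mul_C (t : PowerSeries K) (c : K) {k : ℕ} (hk : k ≠ 0)
    (n : ℕ) :
    coeff n (t * (1 - X ^ k * C c)⁻¹) =
      coeff n t + if k ≤ n then coeff (n - k) (t * (1 - X ^ k * C c)⁻¹) * c else 0 := by
  have h := coeff_mul_one_sub_X_pow_mul_C (t * (1 - X ^ k * C c)⁻¹) c k n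
  rw [mul_assoc, PowerSeries.inv_mul_cancel _ (constantCoeff_one_sub_X_pow_mul_C_ne_zero c hk),
    mul_one] at h
  rw [h, sub_add_cancel]

theorem coe_inv_one_sub_X_pow_mul_C (c : K) {k : ℕ} (hk : k ≠ 0) :
    HahnSeries.ofPowerSeries ℤ K (1 - X ^ k * C c)⁻¹ =
      (HahnSeries.ofPowerSeries ℤ K (1 - X ^ k * C c))⁻¹ := by
  refine eq_inv_of_mul_eq_one_left ?_
  rw [← map_mul, PowerSeries.inv_mul_cancel _ (constantCoeff_one_sub_X_pow_mul_C_ne_zero c hk),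
    map_one]

/-- The expansion of `(1 - λ)⁴ / ((1 - λ y) (1 - λ z))`. -/
def baseSeries (y z : K) : PowerSeries K :=
  (1 - X ^ 1 * C 1) ^ 4 * (1 - X ^ 1 * C y)⁻¹ * (1 - X ^ 1 * C z)⁻¹

/-- The expansion of
`(1 - λ² c)⁴ (1 - λ)⁴ / ((1 - λ²) (1 - λ² d) (1 - λ y) (1 - λ z))`. -/
def rankTwoSeries (y z c d : K) : PowerSeries K :=
  baseSeries y z * (1 - X ^ 2 * C c) ^ 4 * (1 - X ^ 2 * C 1)⁻¹ * (1 - X ^ 2 * C d)⁻¹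

end PowerSeries

theorem RatFunc.coe_C_eq_coe_C {K : Type*} [Field K] (c : K) :
    ((RatFunc.C c : RatFunc K) : LaurentSeries K) =
      HahnSeries.ofPowerSeries ℤ K (PowerSeries.C c) := by
  rw [← RatFunc.algebraMap_C, ← Polynomial.coe_C]
  exact (RatFunc.coe_coe _).symm

theorem RatFunc.coe_X_eq_coe_X {K : Type*} [Field K] :
    ((RatFunc.X : RatFunc K) : LaurentSeries K) =
      HahnSeries.ofPowerSeries ℤ K PowerSeries.X := by
  rw [RatFunc.coe_X, HahnSeries.ofPowerSeries_X]

theorem lcoeff_of_coe_eq {f : RatFunc (RatFunc ℚ)} {s : PowerSeries (RatFunc ℚ)}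
    (h : (f : LaurentSeries (RatFunc ℚ)) = HahnSeries.ofPowerSeries ℤ _ s) (n : ℕ) :
    lcoeff f n = PowerSeries.coeff n s := by
  rw [lcoeff, h, LaurentSeries.coeff_coe_powerSeries]

theorem lcoeff_add (f g : RatFunc (RatFunc ℚ)) (n : ℤ) :
    lcoeff (f + g) n = lcoeff f n + lcoeff g n := by
  rw [lcoeff, map_add, HahnSeries.coeff_add, lcoeff, lcoeff]

theorem lcoeff_X_zpow_mul (f : RatFunc (RatFunc ℚ)) (m n : ℤ) :
    lcoeff (RatFunc.X ^ m * f) n = lcoeff f (n - m) := by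
  rw [lcoeff, map_mul, map_zpow₀, RatFunc.coe_X, ← RatFunc.single_zpow,
    HahnSeries.coeff_single_mul, one_mul, lcoeff]

theorem coe_base (y z a : RatFunc ℚ) :
    ((RatFunc.C a * (1 - RatFunc.X) ^ 4 *
      ((1 - RatFunc.X * RatFunc.C y) * (1 - RatFunc.X * RatFunc.C z))⁻¹ :
        RatFunc (RatFunc ℚ)) : LaurentSeries (RatFunc ℚ)) =
      HahnSeries.ofPowerSeries ℤ _ (PowerSeries.C a * PowerSeries.baseSeries y z) := by
  rw [PowerSeries.baseSeries]
  simp only [map_mul, PowerSeries.coe_inv_one_sub_X_pow_mul_C _ one_ne_zero]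
  simp only [map_mul, map_pow, map_sub, map_one, map_inv₀, RatFunc.coe_C_eq_coe_C,
    RatFunc.coe_X_eq_coe_X, pow_one, mul_one, mul_inv]
  ring

theorem coe_rankTwo (y z a c d : RatFunc ℚ) :
    ((RatFunc.C a * (1 - RatFunc.X ^ 2 * RatFunc.C c) ^ 4 * (1 - RatFunc.X) ^ 4 *
      ((1 - RatFunc.X ^ 2) * (1 - RatFunc.X ^ 2 * RatFunc.C d) *
        (1 - RatFunc.X * RatFunc.C y) * (1 - RatFunc.X * RatFunc.C z))⁻¹ :
        RatFunc (RatFunc ℚ)) : LaurentSeries (RatFunc ℚ)) =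
      HahnSeries.ofPowerSeries ℤ _ (PowerSeries.C a * PowerSeries.rankTwoSeries y z c d) := by
  rw [PowerSeries.rankTwoSeries, PowerSeries.baseSeries]
  simp only [map_mul, PowerSeries.coe_inv_one_sub_X_pow_mul_C _ one_ne_zero,
    PowerSeries.coe_inv_one_sub_X_pow_mul_C _ two_ne_zero]
  simp only [map_mul, map_pow, map_sub, map_one, map_inv₀, RatFunc.coe_C_eq_coe_C,
    RatFunc.coe_X_eq_coe_X, pow_one, mul_one, mul_inv]
  ring

namespace PowerSeries

variable {K : Type*} [Field K]

theorem coeff_one_sub_X_pow_four (n : ℕ) :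
    coeff n ((1 - X ^ 1 * C 1 : PowerSeries K) ^ 4) = (-1) ^ n * (Nat.choose 4 n : K) := by
  have h : (1 - X ^ 1 * C 1 : K⟦X⟧) = rescale (-1) ((1 + Polynomial.X : Polynomial K) : K⟦X⟧) := by
    simp [rescale_X, sub_eq_add_neg]
  rw [h, ← map_pow, coeff_rescale, ← Polynomial.coe_pow, Polynomial.coeff_coe,
    Polynomial.coeff_one_add_X_pow]

theorem coeff_baseSeries (y z : K) :
    coeff 0 (baseSeries y z) = 1 ∧
    coeff 1 (baseSeries y z) = y + z - 4 ∧
    coeff 2 (baseSeries y z) = (y ^ 2 + y * z + z ^ 2) - 4 * (y + z) + 6 ∧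
    coeff 4 (baseSeries y z) =
      (y ^ 4 + y ^ 3 * z + y ^ 2 * z ^ 2 + y * z ^ 3 + z ^ 4)
        - 4 * (y ^ 3 + y ^ 2 * z + y * z ^ 2 + z ^ 3)
        + 6 * (y ^ 2 + y * z + z ^ 2) - 4 * (y + z) + 1 ∧
    coeff 6 (baseSeries y z) =
      (y ^ 6 + y ^ 5 * z + y ^ 4 * z ^ 2 + y ^ 3 * z ^ 3 + y ^ 2 * z ^ 4 + y * z ^ 5 + z ^ 6)
        - 4 * (y ^ 5 + y ^ 4 * z + y ^ 3 * z ^ 2 + y ^ 2 * z ^ 3 + y * z ^ 4 + z ^ 5)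
        + 6 * (y ^ 4 + y ^ 3 * z + y ^ 2 * z ^ 2 + y * z ^ 3 + z ^ 4)
        - 4 * (y ^ 3 + y ^ 2 * z + y * z ^ 2 + z ^ 3) + (y ^ 2 + y * z + z ^ 2) := by
  have zero (t : K⟦X⟧) (c : K) :
      coeff 0 (t * (1 - X ^ 1 * C c)⁻¹) = coeff 0 t := by
    rw [coeff_mul_inv_one_sub_X_pow_mul_C _ _ one_ne_zero, if_neg (by lia), add_zero]
  have succ (t : K⟦X⟧) (c : K) (n : ℕ) : coeff (n + 1) (t * (1 - X ^ 1 * C c)⁻¹) =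
      coeff (n + 1) t + coeff n (t * (1 - X ^ 1 * C c)⁻¹) * c := by
    rw [coeff_mul_inv_one_sub_X_pow_mul_C _ _ one_ne_zero, if_pos (by lia), Nat.add_sub_cancel]
  simp only [baseSeries, zero, succ _ _ 0, succ _ _ 1, succ _ _ 2, succ _ _ 3, succ _ _ 4,
    succ _ _ 5, coeff_one_sub_X_pow_four]
  refine ⟨?_, ?_, ?_, ?_, ?_⟩ <;> norm_num [Nat.choose] <;> ring

theorem coeff_rankTwoSeries (y z c d : K) :
    coeff 0 (rankTwoSeries y z c d) = coeff 0 (baseSeries y z) ∧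
    coeff 2 (rankTwoSeries y z c d) =
      coeff 2 (baseSeries y z) + coeff 0 (baseSeries y z) * (1 + d - 4 * c) ∧
    coeff 4 (rankTwoSeries y z c d) =
      coeff 4 (baseSeries y z) + coeff 2 (baseSeries y z) * (1 + d - 4 * c)
        + coeff 0 (baseSeries y z) * (1 + d + d ^ 2 - 4 * c * (1 + d) + 6 * c ^ 2) ∧
    coeff 6 (rankTwoSeries y z c d) =
      coeff 6 (baseSeries y z) + coeff 4 (baseSeries y z) * (1 + d - 4 * c)
        + coeff 2 (baseSeries y z) * (1 + d + d ^ 2 - 4 * c * (1 + d) + 6 * c ^ 2)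
        + coeff 0 (baseSeries y z) *
          (1 + d + d ^ 2 + d ^ 3 - 4 * c * (1 + d + d ^ 2) + 6 * c ^ 2 * (1 + d) - 4 * c ^ 3) := by
  have zero (t : K⟦X⟧) (c : K) :
      coeff 0 (t * (1 - X ^ 2 * C c)⁻¹) = coeff 0 t := by
    simp [coeff_mul_inv_one_sub_X_pow_mul_C _ _ two_ne_zero 0]
  have add_two (t : K⟦X⟧) (c : K) (n : ℕ) : coeff (n + 2) (t * (1 - X ^ 2 * C c)⁻¹) =
      coeff (n + 2) t + coeff n (t * (1 - X ^ 2 * C c)⁻¹) * c := by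
    simp [coeff_mul_inv_one_sub_X_pow_mul_C _ _ two_ne_zero (n + 2)]
  simp only [rankTwoSeries, pow_succ (1 - X ^ 2 * C c), pow_zero, one_mul, ← mul_assoc,
    zero, add_two _ _ 0, add_two _ _ 2, add_two _ _ 4, coeff_mul_one_sub_X_pow_mul_C]
  refine ⟨?_, ?_, ?_, ?_⟩ <;> norm_num [-coeff_zero_eq_constantCoeff] <;> ring

end PowerSeries

/-- `g = 2`, `p = 0`: with `Ã₁(e)` the `λ^e`-coefficient of
`y⁻¹(1-λ)⁴/((1-λy)(1-λy⁻¹))`, `Ã₂(e)` the `λ^e`-coefficient of the Laurent expansion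
of `Ω_{(1,1)} + Ω_{(2)}`, and `H̃₁ = (1-y)⁴/y³`, one has
`Ã₂(0) - Ã₂(4) + (y²+1+y⁻²)Ã₁(0)H̃₁ + (y+y⁻¹)Ã₁(1)H̃₁ + Ã₁(2)H̃₁ - (1/2)H̃₁²`
`= -(y+y⁻¹)(1-y)⁴(2+4y²-8y³+7y⁴-12y⁵+14y⁶-4y⁷+5y⁸)/(2y⁹(1+y²))`,
i.e. the rank-two even-degree recursion at `(2,0)` has the solution
`H̃(2,0) = (1-y)⁴(2+4y²-8y³+7y⁴-12y⁵+14y⁶-4y⁷+5y⁸)/(2y⁹(1+y²))`. -/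
theorem stmt_17 :
    let y : RatFunc ℚ := RatFunc.X
    let lam : RatFunc (RatFunc ℚ) := RatFunc.X
    let C : RatFunc ℚ →+* RatFunc (RatFunc ℚ) := RatFunc.C
    let A1 : RatFunc (RatFunc ℚ) :=
      C y⁻¹ * (1 - lam) ^ 4 * ((1 - lam * C y) * (1 - lam * C y⁻¹))⁻¹
    let Ω11 : RatFunc (RatFunc ℚ) :=
      C (y ^ (-2 : ℤ)) * (1 - lam ^ 2 * C y⁻¹) ^ 4 * (1 - lam) ^ 4 *
        ((1 - lam ^ 2) * (1 - lam ^ 2 * C (y ^ (-2 : ℤ))) *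
          (1 - lam * C y) * (1 - lam * C y⁻¹))⁻¹
    let Ω2 : RatFunc (RatFunc ℚ) :=
      lam ^ (-2 : ℤ) * C (y ^ (-4 : ℤ)) * (1 - lam ^ 2 * C y) ^ 4 * (1 - lam) ^ 4 *
        ((1 - lam ^ 2) * (1 - lam ^ 2 * C (y ^ 2)) *
          (1 - lam * C y) * (1 - lam * C y⁻¹))⁻¹
    let H1 : RatFunc ℚ := (1 - y) ^ 4 / y ^ 3
    lcoeff (Ω11 + Ω2) 0 - lcoeff (Ω11 + Ω2) 4
      + (y ^ 2 + 1 + y ^ (-2 : ℤ)) * lcoeff A1 0 * H1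
      + (y + y⁻¹) * lcoeff A1 1 * H1 + lcoeff A1 2 * H1
      - (1 / 2 : RatFunc ℚ) * H1 ^ 2
    = -(y + y⁻¹) *
        ((1 - y) ^ 4 *
            (2 + 4 * y ^ 2 - 8 * y ^ 3 + 7 * y ^ 4 - 12 * y ^ 5 + 14 * y ^ 6
              - 4 * y ^ 7 + 5 * y ^ 8) /
          (2 * y ^ 9 * (1 + y ^ 2))) := by
  intro y lam C A1 Ω11 Ω2 H1
  have hy : y ≠ 0 := RatFunc.X_ne_zero
  have hy2 : 1 + y ^ 2 ≠ 0 := by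
    have h : (1 + Polynomial.X ^ 2 : Polynomial ℚ) ≠ 0 := by
      intro h
      simpa using congrArg (Polynomial.coeff · 0) h
    simpa [y] using RatFunc.algebraMap_ne_zero h
  have hA1 (n : ℕ) := lcoeff_of_coe_eq (coe_base y y⁻¹ y⁻¹) n
  have hΩ11 (n : ℕ) :=
    lcoeff_of_coe_eq (coe_rankTwo y y⁻¹ (y ^ (-2 : ℤ)) y⁻¹ (y ^ (-2 : ℤ))) n
  have hΩ2 (n : ℕ) : lcoeff Ω2 n = PowerSeries.coeff (n + 2)
      (PowerSeries.C (y ^ (-4 : ℤ)) * PowerSeries.rankTwoSeries y y⁻¹ y (y ^ 2)) := by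
    rw [← lcoeff_of_coe_eq (coe_rankTwo y y⁻¹ (y ^ (-4 : ℤ)) y (y ^ 2))]
    simp only [Ω2, mul_assoc]
    rw [lcoeff_X_zpow_mul, sub_neg_eq_add, Nat.cast_add, Nat.cast_ofNat]
  change ∀ n : ℕ, lcoeff A1 n = _ at hA1
  change ∀ n : ℕ, lcoeff Ω11 n = _ at hΩ11
  obtain ⟨a0, a1, a2, a4, a6⟩ := PowerSeries.coeff_baseSeries y y⁻¹
  obtain ⟨b0, -, b4, -⟩ := PowerSeries.coeff_rankTwoSeries y y⁻¹ y⁻¹ (y ^ (-2 : ℤ))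
  obtain ⟨-, c2, -, c6⟩ := PowerSeries.coeff_rankTwoSeries y y⁻¹ y (y ^ 2)
  simp only [PowerSeries.coeff_C_mul] at hA1 hΩ11 hΩ2
  have A0 := hA1 0
  have A1one := hA1 1
  have A2 := hA1 2
  have O0 := hΩ11 0
  have O4 := hΩ11 4
  have P0 := hΩ2 0
  have P4 := hΩ2 4
  norm_num only at A0 A1one A2 O0 O4 P0 P4
  rw [lcoeff_add, lcoeff_add, A0, A1one, A2, O0, O4, P0, P4, b0, b4, c2, c6, a0, a1, a2, a4, a6]
  simp only [H1, zpow_neg]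
  field_simp
  ring

end
end

section
/- Fix an integer g ≥ 2, a real number δ_c > 0, and functions A₊, A₋, h : ℤ_{≥1} × ℤ → ℚ(y). Then the following two statements are equivalent: (i) for every γ ∈ ℤ_{≥1} × ℤ, A₊(γ) − A₋(γ) = Σ_{l≥2} (1/(l−1)!) Σ A₋(γ_1) ∏_{i=2}^{l} h(γ_i), the inner sum over ordered tuples (γ_1,…,γ_l) in ℤ_{≥1} × ℤ with γ_1 + ⋯ + γ_l = γ and μ_{δ_c}(γ_1) = μ(γ_2) = ⋯ = μ(γ_l); (ii) for every γ ∈ ℤ_{≥1} × ℤ, A₋(γ) − A₊(γ) = Σ_{l≥2} ((−1)^{l−1}/(l−1)!) Σ A₊(γ_1) ∏_{i=2}^{l} h(γ_i), with the same index set. In both (i) and (ii) the inner sums have only finitely many terms for each γ and l, and only finitely many l contribute. -/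
open scoped Classical

noncomputable section

/-- The wallcrossing index condition at a critical parameter `δ_c`: the ordered tuple
`(γ₁, γ₂, …, γ_l)` (with `l ≥ 2`), encoded as `γ₁` together with the nonempty list
`L = [γ₂,…,γ_l]`, consists of elements of `ℤ_{≥1} × ℤ`, sums to `γ`, and satisfies
`μ_{δ_c}(γ₁) = μ(γ₂) = ⋯ = μ(γ_l)` (where `μ_δ(r,e) = (e+δ)/r`, `μ(r,e) = e/r`). -/
def Cw (δc : ℝ) (γ γ₁ : ℤ × ℤ) (L : List (ℤ × ℤ)) : Prop :=
  L ≠ [] ∧ 1 ≤ γ₁.1 ∧ (∀ x ∈ L, 1 ≤ x.1) ∧ γ₁ + L.sum = γ ∧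
    ∀ x ∈ L, ((x.2 : ℝ) / (x.1 : ℝ)) = (((γ₁.2 : ℝ) + δc) / (γ₁.1 : ℝ))

/-- `Cw` without the requirement that the list be nonempty. -/
def WallTuple (δ : ℝ) (γ γ₁ : ℤ × ℤ) (L : List (ℤ × ℤ)) : Prop :=
  1 ≤ γ₁.1 ∧ (∀ x ∈ L, 1 ≤ x.1) ∧ γ₁ + L.sum = γ ∧
    ∀ x ∈ L, (x.2 : ℝ) / x.1 = ((γ₁.2 : ℝ) + δ) / γ₁.1

/-- The classes `x` with `1 ≤ rk x < rk γ` and `μ(x) = μ_δ(γ)`. -/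
def wallSteps (δ : ℝ) (γ : ℤ × ℤ) : Finset (ℤ × ℤ) :=
  ((Finset.Ico 1 γ.1).image fun r : ℤ => (r, ⌊((γ.2 : ℝ) + δ) / γ.1 * r⌋)).filter
    fun x => (x.2 : ℝ) / x.1 = ((γ.2 : ℝ) + δ) / γ.1

theorem mem_wallSteps {δ : ℝ} {γ x : ℤ × ℤ} :
    x ∈ wallSteps δ γ ↔
      1 ≤ x.1 ∧ x.1 < γ.1 ∧ (x.2 : ℝ) / x.1 = ((γ.2 : ℝ) + δ) / γ.1 := by
  obtain ⟨r, e⟩ := x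
  simp only [wallSteps, Finset.mem_filter, Finset.mem_image, Finset.mem_Ico, Prod.mk.injEq]
  constructor
  · rintro ⟨⟨r', ⟨h1, h2⟩, rfl, -⟩, h3⟩
    exact ⟨h1, h2, h3⟩
  · rintro ⟨h1, h2, h3⟩
    refine ⟨⟨r, ⟨h1, h2⟩, rfl, ?_⟩, h3⟩
    have hr : (r : ℝ) ≠ 0 := by
      have : r ≠ 0 := by lia
      exact_mod_cast this
    rw [← h3, div_mul_cancel₀ _ hr, Int.floor_intCast]

/-- Removing a class of slope `s` does not change a `δ`-slope equal to `s`. -/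
theorem deltaSlope_sub {δ : ℝ} {γ x : ℤ × ℤ} {s : ℝ} (hx : 1 ≤ x.1) (hγ : 1 ≤ γ.1 - x.1)
    (hs : (x.2 : ℝ) / x.1 = s) :
    (((γ - x).2 : ℝ) + δ) / ((γ - x).1 : ℝ) = s ↔ ((γ.2 : ℝ) + δ) / γ.1 = s := by
  have h1 : (1 : ℝ) ≤ x.1 := by exact_mod_cast hx
  have h2 : (1 : ℝ) ≤ γ.1 - x.1 := by exact_mod_cast hγ
  rw [div_eq_iff (by linarith)] at hs
  simp only [Prod.fst_sub, Prod.snd_sub, Int.cast_sub]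
  rw [div_eq_iff (by linarith), div_eq_iff (by linarith), hs]
  constructor <;> intro h <;> linarith

theorem WallTuple.tail {δ : ℝ} {γ γ₁ x : ℤ × ℤ} {L : List (ℤ × ℤ)}
    (H : WallTuple δ γ γ₁ (x :: L)) : WallTuple δ (γ - x) γ₁ L := by
  obtain ⟨h1, h2, h3, h4⟩ := H
  exact ⟨h1, fun y hy => h2 y (List.mem_cons_of_mem _ hy),
    by rw [← h3, List.sum_cons]; abel, fun y hy => h4 y (List.mem_cons_of_mem _ hy)⟩

theorem WallTuple.length_lt {δ : ℝ} {γ γ₁ : ℤ × ℤ} {L : List (ℤ × ℤ)}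
    (H : WallTuple δ γ γ₁ L) : (L.length : ℤ) < γ.1 := by
  induction L generalizing γ with
  | nil =>
    obtain ⟨h1, -, h3, -⟩ := H
    simp only [List.sum_nil, add_zero] at h3
    subst h3
    simp only [List.length_nil, Nat.cast_zero]
    lia
  | cons x L ih =>
    have hL := H.tail
    obtain ⟨h1, h2, h3, h4⟩ := H
    have := ih hL
    have hx := h2 x List.mem_cons_self
    simp only [Prod.fst_sub] at this
    simp only [List.length_cons, Nat.cast_add, Nat.cast_one]
    linarith

theorem WallTuple.deltaSlope_eq {δ : ℝ} {γ γ₁ : ℤ × ℤ} {L : List (ℤ × ℤ)}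
    (H : WallTuple δ γ γ₁ L) : ((γ.2 : ℝ) + δ) / γ.1 = ((γ₁.2 : ℝ) + δ) / γ₁.1 := by
  induction L generalizing γ with
  | nil =>
    obtain ⟨-, -, h3, -⟩ := H
    simp only [List.sum_nil, add_zero] at h3
    rw [h3]
  | cons x L ih =>
    have hL := H.tail
    obtain ⟨h1, h2, h3, h4⟩ := H
    have hlt := hL.length_lt
    simp only [Prod.fst_sub] at hlt
    exact (deltaSlope_sub (h2 x List.mem_cons_self) (by lia)
      (h4 x List.mem_cons_self)).1 (ih hL)

theorem wallTuple_cons {δ : ℝ} {γ γ₁ x : ℤ × ℤ} {L : List (ℤ × ℤ)} :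
    WallTuple δ γ γ₁ (x :: L) ↔ x ∈ wallSteps δ γ ∧ WallTuple δ (γ - x) γ₁ L := by
  rw [mem_wallSteps]
  constructor
  · intro H
    have hs := H.deltaSlope_eq
    have hL := H.tail
    obtain ⟨h1, h2, h3, h4⟩ := H
    have hlt := hL.length_lt
    simp only [Prod.fst_sub] at hlt
    exact ⟨⟨h2 x List.mem_cons_self, by lia, (h4 x List.mem_cons_self).trans hs.symm⟩, hL⟩
  · rintro ⟨⟨hx, hlt, hs⟩, hL⟩
    have hs' := (deltaSlope_sub (δ := δ) hx (by lia) hs).2 rfl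
    have hs₁ := hL.deltaSlope_eq
    obtain ⟨h1, h2, h3, h4⟩ := hL
    refine ⟨h1, List.forall_mem_cons.2 ⟨hx, h2⟩, ?_,
      List.forall_mem_cons.2 ⟨hs.trans (hs'.symm.trans hs₁), h4⟩⟩
    rw [List.sum_cons, add_left_comm, h3, add_sub_cancel]

/-- The wall tuples `(γ₁, L)` of total class `γ` with `L` of length `n`. -/
def wallTuples (δ : ℝ) : ℕ → ℤ × ℤ → Finset ((ℤ × ℤ) × List (ℤ × ℤ))
  | 0, γ => {(γ, [])}
  | n + 1, γ => (wallSteps δ γ).biUnion fun x =>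
      (wallTuples δ n (γ - x)).image fun t => (t.1, x :: t.2)

theorem mem_wallTuples {δ : ℝ} {n : ℕ} {γ : ℤ × ℤ} (hγ : 1 ≤ γ.1)
    {t : (ℤ × ℤ) × List (ℤ × ℤ)} :
    t ∈ wallTuples δ n γ ↔ t.2.length = n ∧ WallTuple δ γ t.1 t.2 := by
  induction n generalizing γ t with
  | zero =>
    obtain ⟨γ₁, L⟩ := t
    simp only [wallTuples, Finset.mem_singleton, Prod.mk.injEq, List.length_eq_zero_iff]
    constructor
    · rintro ⟨rfl, rfl⟩
      exact ⟨rfl, hγ, by simp, by simp, by simp⟩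
    · rintro ⟨rfl, -, -, h, -⟩
      exact ⟨by simpa using h, rfl⟩
  | succ n ih =>
    obtain ⟨γ₁, L⟩ := t
    simp only [wallTuples, Finset.mem_biUnion, Finset.mem_image, Prod.mk.injEq]
    constructor
    · rintro ⟨x, hx, ⟨γ₂, L'⟩, ht, rfl, rfl⟩
      have hx' := mem_wallSteps.1 hx
      rw [ih (by simp only [Prod.fst_sub]; lia)] at ht
      exact ⟨by simpa using ht.1, wallTuple_cons.2 ⟨hx, ht.2⟩⟩
    · rintro ⟨hl, H⟩
      obtain _ | ⟨x, L⟩ := L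
      · simp at hl
      · obtain ⟨hx, hL⟩ := wallTuple_cons.1 H
        have hx' := mem_wallSteps.1 hx
        refine ⟨x, hx, (γ₁, L), ?_, rfl, rfl⟩
        rw [ih (by simp only [Prod.fst_sub]; lia)]
        exact ⟨by simpa using hl, hL⟩

theorem cw_iff_exists_mem_wallTuples {δ : ℝ} {N : ℕ} {γ : ℤ × ℤ} (hγ : 1 ≤ γ.1)
    (hN : γ.1 ≤ N) {t : (ℤ × ℤ) × List (ℤ × ℤ)} :
    Cw δ γ t.1 t.2 ↔ ∃ n ∈ Finset.Ico 1 (N + 1), t ∈ wallTuples δ n γ := by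
  simp only [mem_wallTuples hγ, Finset.mem_Ico]
  constructor
  · rintro ⟨hne, H : WallTuple δ γ t.1 t.2⟩
    have := H.length_lt
    have := List.length_pos_iff.2 hne
    exact ⟨_, by lia, rfl, H⟩
  · rintro ⟨n, hn, rfl, H⟩
    exact ⟨List.length_pos_iff.1 hn.1, H⟩

theorem finite_setOf_cw (δ : ℝ) {γ : ℤ × ℤ} (hγ : 1 ≤ γ.1) :
    {t : (ℤ × ℤ) × List (ℤ × ℤ) | Cw δ γ t.1 t.2}.Finite := by
  refine ((Finset.Ico 1 (γ.1.toNat + 1)).biUnion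
    fun n => wallTuples δ n γ).finite_toSet.subset fun t ht => ?_
  simpa using (cw_iff_exists_mem_wallTuples hγ (by lia)).1 ht

section Operator

variable {K : Type*} [Field K]

/-- The operator adding one class of the critical slope with weight `h`, cut off at rank `N`. -/
def wallOp (δ : ℝ) (h : ℤ × ℤ → K) (N : ℕ) : Module.End K (ℤ × ℤ → K) where
  toFun A γ := if γ.1 ≤ N then ∑ x ∈ wallSteps δ γ, h x * A (γ - x) else 0
  map_add' A B := by
    ext γ
    by_cases hγ : γ.1 ≤ N <;> simp [hγ, mul_add, Finset.sum_add_distrib]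
  map_smul' c A := by
    ext γ
    by_cases hγ : γ.1 ≤ N <;> simp [hγ, Finset.mul_sum, mul_left_comm]

theorem wallOp_apply {δ : ℝ} {h : ℤ × ℤ → K} {N : ℕ} {A : ℤ × ℤ → K} {γ : ℤ × ℤ}
    (hγ : γ.1 ≤ N) : wallOp δ h N A γ = ∑ x ∈ wallSteps δ γ, h x * A (γ - x) :=
  if_pos hγ

theorem wallOp_apply_of_lt {δ : ℝ} {h : ℤ × ℤ → K} {N : ℕ} {A : ℤ × ℤ → K} {γ : ℤ × ℤ}
    (hγ : N < γ.1) : wallOp δ h N A γ = 0 :=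
  if_neg hγ.not_ge

theorem wallOp_neg (δ : ℝ) (h : ℤ × ℤ → K) (N : ℕ) : wallOp δ (-h) N = -wallOp δ h N := by
  ext1 A
  funext γ
  rw [LinearMap.neg_apply, Pi.neg_apply]
  rcases le_or_gt γ.1 (N : ℤ) with hγ | hγ
  · simp [wallOp_apply hγ]
  · simp [wallOp_apply_of_lt hγ]

theorem wallOp_pow_apply_eq_zero {δ : ℝ} {h : ℤ × ℤ → K} {N n : ℕ} {A : ℤ × ℤ → K}
    {γ : ℤ × ℤ} (hγ : γ.1 ≤ n + 1) : (wallOp δ h N ^ (n + 1)) A γ = 0 := by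
  induction n generalizing γ with
  | zero =>
    rw [zero_add, pow_one]
    rcases le_or_gt γ.1 (N : ℤ) with hN | hN
    · rw [wallOp_apply hN]
      refine Finset.sum_eq_zero fun x hx => ?_
      have := mem_wallSteps.1 hx
      push_cast at hγ
      lia
    · exact wallOp_apply_of_lt hN
  | succ n ih =>
    rw [pow_succ', Module.End.mul_apply]
    rcases le_or_gt γ.1 (N : ℤ) with hN | hN
    · rw [wallOp_apply hN]
      refine Finset.sum_eq_zero fun x hx => ?_
      have := mem_wallSteps.1 hx
      rw [ih (by simp only [Prod.fst_sub]; push_cast at hγ; lia), mul_zero]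
    · exact wallOp_apply_of_lt hN

theorem wallOp_pow_eq_zero (δ : ℝ) (h : ℤ × ℤ → K) (N : ℕ) : wallOp δ h N ^ (N + 1) = 0 := by
  ext1 A
  funext γ
  rcases le_or_gt γ.1 (N : ℤ) with hN | hN
  · exact wallOp_pow_apply_eq_zero (by lia)
  · rw [pow_succ', Module.End.mul_apply, wallOp_apply_of_lt hN]
    rfl

theorem wallOp_pow_apply {δ : ℝ} {h : ℤ × ℤ → K} {N n : ℕ} {A : ℤ × ℤ → K}
    {γ : ℤ × ℤ} (hγ : γ.1 ≤ N) :
    (wallOp δ h N ^ n) A γ = ∑ t ∈ wallTuples δ n γ, A t.1 * (t.2.map h).prod := by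
  induction n generalizing γ with
  | zero => simp [wallTuples]
  | succ n ih =>
    rw [pow_succ', Module.End.mul_apply, wallOp_apply hγ, wallTuples, Finset.sum_biUnion]
    · refine Finset.sum_congr rfl fun x hx => ?_
      have := mem_wallSteps.1 hx
      rw [Finset.sum_image, ih (by simp only [Prod.fst_sub]; lia), Finset.mul_sum]
      · simp [mul_left_comm]
      · rintro ⟨a, L⟩ - ⟨b, M⟩ - hab
        simpa using hab
    · intro x _ y _ hxy
      simp only [Function.onFun, Finset.disjoint_left, Finset.mem_image]
      rintro _ ⟨t, -, rfl⟩ ⟨u, -, hu⟩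
      simp only [Prod.mk.injEq, List.cons.injEq] at hu
      exact hxy hu.2.1.symm

theorem wallOp_pow_congr {δ : ℝ} {h : ℤ × ℤ → K} {N n : ℕ} {A B : ℤ × ℤ → K}
    (hAB : ∀ γ : ℤ × ℤ, 1 ≤ γ.1 → γ.1 ≤ N → A γ = B γ) {γ : ℤ × ℤ} (h1 : 1 ≤ γ.1)
    (hγ : γ.1 ≤ N) : (wallOp δ h N ^ n) A γ = (wallOp δ h N ^ n) B γ := by
  induction n generalizing γ with
  | zero => simpa using hAB γ h1 hγ
  | succ n ih =>
    simp only [pow_succ', Module.End.mul_apply, wallOp_apply hγ]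
    refine Finset.sum_congr rfl fun x hx => ?_
    have := mem_wallSteps.1 hx
    rw [ih (by simp only [Prod.fst_sub]; lia) (by simp only [Prod.fst_sub]; lia)]

variable [CharZero K]

theorem exp_wallOp_apply (δ : ℝ) (h : ℤ × ℤ → K) (N : ℕ) (A : ℤ × ℤ → K) (γ : ℤ × ℤ) :
    IsNilpotent.exp (wallOp δ h N) A γ =
      ∑ n ∈ Finset.range (N + 1), (n.factorial : K)⁻¹ * (wallOp δ h N ^ n) A γ := by
  rw [IsNilpotent.exp_eq_sum (wallOp_pow_eq_zero δ h N), LinearMap.sum_apply, Finset.sum_apply]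
  refine Finset.sum_congr rfl fun n _ => ?_
  rw [LinearMap.smul_apply, Pi.smul_apply, Rat.smul_def]
  push_cast
  rfl

theorem exp_wallOp_congr {δ : ℝ} {h : ℤ × ℤ → K} {N : ℕ} {A B : ℤ × ℤ → K}
    (hAB : ∀ γ : ℤ × ℤ, 1 ≤ γ.1 → γ.1 ≤ N → A γ = B γ) {γ : ℤ × ℤ} (h1 : 1 ≤ γ.1)
    (hγ : γ.1 ≤ N) :
    IsNilpotent.exp (wallOp δ h N) A γ = IsNilpotent.exp (wallOp δ h N) B γ := by
  simp only [exp_wallOp_apply, wallOp_pow_congr hAB h1 hγ]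

/-- The right-hand side of the wallcrossing formula. -/
def wallSum (δ : ℝ) (h A : ℤ × ℤ → K) (γ : ℤ × ℤ) : K :=
  ∑ᶠ t : (ℤ × ℤ) × List (ℤ × ℤ),
    if Cw δ γ t.1 t.2 then (t.2.length.factorial : K)⁻¹ * A t.1 * (t.2.map h).prod else 0

theorem exp_wallOp_apply_eq_add_wallSum {δ : ℝ} {h : ℤ × ℤ → K} {N : ℕ} {A : ℤ × ℤ → K}
    {γ : ℤ × ℤ} (h1 : 1 ≤ γ.1) (hγ : γ.1 ≤ N) :
    IsNilpotent.exp (wallOp δ h N) A γ = A γ + wallSum δ h A γ := by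
  have hsum : wallSum δ h A γ = ∑ n ∈ Finset.Ico 1 (N + 1), ∑ t ∈ wallTuples δ n γ,
      (t.2.length.factorial : K)⁻¹ * A t.1 * (t.2.map h).prod := by
    rw [← Finset.sum_biUnion]
    · rw [wallSum, finsum_eq_sum_of_support_subset
        (s := (Finset.Ico 1 (N + 1)).biUnion fun n => wallTuples δ n γ)]
      · refine Finset.sum_congr rfl fun t ht => if_pos ?_
        exact (cw_iff_exists_mem_wallTuples h1 hγ).2 (Finset.mem_biUnion.1 ht)
      · intro t ht
        have hC : Cw δ γ t.1 t.2 := by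
          by_contra hC
          exact ht (if_neg hC)
        exact Finset.mem_biUnion.2 ((cw_iff_exists_mem_wallTuples h1 hγ).1 hC)
    · intro m _ n _ hmn
      refine Finset.disjoint_left.2 fun t hm hn => hmn ?_
      exact ((mem_wallTuples h1).1 hm).1.symm.trans ((mem_wallTuples h1).1 hn).1
  rw [exp_wallOp_apply, Finset.range_eq_Ico, Finset.sum_eq_sum_Ico_succ_bot (by lia), hsum]
  congr 1
  · simp
  · refine Finset.sum_congr rfl fun n _ => ?_
    rw [wallOp_pow_apply hγ, Finset.mul_sum]
    refine Finset.sum_congr rfl fun t ht => ?_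
    rw [((mem_wallTuples h1).1 ht).1, mul_assoc]

theorem wallSum_inversion {δ : ℝ} {h A B : ℤ × ℤ → K}
    (H : ∀ γ : ℤ × ℤ, 1 ≤ γ.1 → A γ - B γ = wallSum δ h B γ) (γ : ℤ × ℤ) (hγ : 1 ≤ γ.1) :
    B γ - A γ = wallSum δ (-h) A γ := by
  have hN : γ.1 ≤ (γ.1.toNat : ℤ) := by lia
  set N := γ.1.toNat
  have hA : ∀ β : ℤ × ℤ, 1 ≤ β.1 → β.1 ≤ N → A β = IsNilpotent.exp (wallOp δ h N) B β :=
    fun β h1 h2 => by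
      rw [exp_wallOp_apply_eq_add_wallSum h1 h2, ← H β h1, add_sub_cancel]
  have hinv := exp_wallOp_congr (h := -h) (δ := δ) hA hγ hN
  rw [← Module.End.mul_apply, wallOp_neg, IsNilpotent.exp_neg_mul_exp_self
    ⟨_, wallOp_pow_eq_zero δ h N⟩, Module.End.one_apply, ← wallOp_neg,
    exp_wallOp_apply_eq_add_wallSum hγ hN] at hinv
  rw [← hinv, add_sub_cancel_left]

end Operator

/-- equivalence of the wallcrossing formula across a critical stability
parameter with its inverted form, together with finiteness of the index sets. -/
theorem stmt_19 (g : ℤ) (hg : 2 ≤ g) (δc : ℝ) (hδc : 0 < δc)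
    (Ap Am h : ℤ × ℤ → RatFunc ℚ) :
    (∀ γ : ℤ × ℤ, 1 ≤ γ.1 →
      {t : (ℤ × ℤ) × List (ℤ × ℤ) | Cw δc γ t.1 t.2}.Finite) ∧
    ((∀ γ : ℤ × ℤ, 1 ≤ γ.1 →
        Ap γ - Am γ =
          ∑ᶠ t : (ℤ × ℤ) × List (ℤ × ℤ),
            if Cw δc γ t.1 t.2 then
              RatFunc.C (1 / (Nat.factorial t.2.length : ℚ)) * Am t.1 *
                (t.2.map h).prod
            else 0)
      ↔
      (∀ γ : ℤ × ℤ, 1 ≤ γ.1 →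
        Am γ - Ap γ =
          ∑ᶠ t : (ℤ × ℤ) × List (ℤ × ℤ),
            if Cw δc γ t.1 t.2 then
              RatFunc.C ((-1 : ℚ) ^ t.2.length / (Nat.factorial t.2.length : ℚ)) *
                Ap t.1 * (t.2.map h).prod
            else 0)) := by
  have hC (q : ℚ) (n : ℕ) :
      RatFunc.C (q / (n.factorial : ℚ)) = RatFunc.C q * (n.factorial : RatFunc ℚ)⁻¹ := by
    rw [map_div₀, map_natCast, div_eq_mul_inv]
  have hplus (γ : ℤ × ℤ) : (∑ᶠ t : (ℤ × ℤ) × List (ℤ × ℤ),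
      if Cw δc γ t.1 t.2 then
        RatFunc.C (1 / (Nat.factorial t.2.length : ℚ)) * Am t.1 * (t.2.map h).prod
      else 0) = wallSum δc h Am γ := by
    simp only [hC, map_one, one_mul, wallSum]
  have hprod (L : List (ℤ × ℤ)) : (L.map (-h)).prod = (-1) ^ L.length * (L.map h).prod := by
    induction L with
    | nil => simp
    | cons x L ih => simp [ih, pow_succ]; ring
  have hminus (γ : ℤ × ℤ) : (∑ᶠ t : (ℤ × ℤ) × List (ℤ × ℤ),
      if Cw δc γ t.1 t.2 then
        RatFunc.C ((-1 : ℚ) ^ t.2.length / (Nat.factorial t.2.length : ℚ)) *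
          Ap t.1 * (t.2.map h).prod
      else 0) = wallSum δc (-h) Ap γ := by
    refine finsum_congr fun t => ?_
    rw [hC, hprod, map_pow, map_neg, map_one]
    congr 1
    ring
  simp only [hplus, hminus]
  refine ⟨fun γ hγ => finite_setOf_cw δc hγ, wallSum_inversion, fun H => ?_⟩
  simpa only [neg_neg] using wallSum_inversion H

end
end
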